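/- Let 1 < p < n + 2. Then for all φ ∈ C_0^∞(ℝ^{n+1}), ‖φ‖_{L^{p*}(ℝ^{n+1})} ≲ ‖∇_x φ‖_{L^p(ℝ^{n+1})} + ‖D_t^{1/2} φ‖_{L^p(ℝ^{n+1})}, where 1/p* = 1/p − 1/(n+2). -/

import Mathlib

open MeasureTheory Real Complex Filter Set Metric
open scoped FourierTransform Topology ENNReal NNReal

noncomputable section

/-- Spatial variable: `ℝⁿ`. -/
abbrev Spc (n : ℕ) := Fin n → ℝ
/-- Space-time point `(t,x) ∈ ℝ^{1+n}`. -/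
abbrev Pt (n : ℕ) := ℝ × Spc n
/-- Values `ℂᵐ`. -/
abbrev Val (m : ℕ) := Fin m → ℂ
/-- Gradient-type values `ℂ^{nm}`: index `i` for the spatial direction, `α` for the component. -/
abbrev Grad (n m : ℕ) := Fin n → Fin m → ℂ

variable {n m : ℕ}

/-- Hermitian dot product `v ⋅ conj w` on `ℂ^{nm}`. -/
def gdot (v w : Grad n m) : ℂ := ∑ i, ∑ α, v i α * (starRingEnd ℂ) (w i α)

/-- Hermitian dot product `v ⋅ conj w` on `ℂᵐ`. -/
def vdot (v w : Val m) : ℂ := ∑ α, v α * (starRingEnd ℂ) (w α)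

/-- Euclidean norm on `ℂ^{nm}`. -/
def gnorm (G : Grad n m) : ℝ := Real.sqrt (∑ i, ∑ α, ‖G i α‖ ^ 2)

/-- Euclidean norm on `ℂᵐ`. -/
def vnorm (v : Val m) : ℝ := Real.sqrt (∑ α, ‖v α‖ ^ 2)

/-- Spatial gradient of a (smooth) function on space-time. -/
def tgrad (φ : Pt n → Val m) (z : Pt n) : Grad n m :=
  fun i α => fderiv ℝ φ z ((0 : ℝ), Pi.single i (1:ℝ)) α

/-- Spatial gradient of a (smooth) function on space. -/
def tgradx (v : Spc n → Val m) (x : Spc n) : Grad n m :=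
  fun i α => fderiv ℝ v x (Pi.single i (1:ℝ)) α

/-- Time derivative `∂_t φ` of a smooth function on space-time. -/
def tdt (φ : Pt n → Val m) (z : Pt n) : Val m := fun α => fderiv ℝ φ z ((1:ℝ), (0 : Spc n)) α

/-- Scalar spatial partial derivative `∂_i φ`. -/
def tdx (φ : Pt n → ℂ) (i : Fin n) (z : Pt n) : ℂ := fderiv ℝ φ z ((0:ℝ), Pi.single i (1:ℝ))

/-- Scalar time derivative `∂_t φ`. -/
def tdtc (φ : Pt n → ℂ) (z : Pt n) : ℂ := fderiv ℝ φ z ((1:ℝ), (0 : Spc n))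

/-- Test functions for a space-time domain `Ω`. -/
def IsTest (Ω : Set (Pt n)) (φ : Pt n → Val m) : Prop :=
  ContDiff ℝ (⊤:ℕ∞) φ ∧ HasCompactSupport φ ∧ tsupport φ ⊆ Ω

/-- `Du` is the weak (distributional) spatial gradient of `u` on `Ω`. -/
def IsWeakGrad (Ω : Set (Pt n)) (u : Pt n → Val m) (Du : Pt n → Grad n m) : Prop :=
  ∀ φ : Pt n → ℂ, ContDiff ℝ (⊤:ℕ∞) φ → HasCompactSupport φ → tsupport φ ⊆ Ω →
    ∀ i α, ∫ z in Ω, u z α * tdx φ i z = - ∫ z in Ω, Du z i α * φ z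

/-- Coefficients bounded (in `L^∞`) by `M`. -/
def BddCoeff (A : Pt n → (Grad n m →L[ℂ] Grad n m)) (M : ℝ) : Prop := ∀ z, ‖A z‖ ≤ M

/-- Zero-order coefficients bounded by `M`. -/
def BddCoeff0 (B : Pt n → (Val m →L[ℂ] Val m)) (M : ℝ) : Prop := ∀ z, ‖B z‖ ≤ M

/-- The Gårding inequality for `A`, with constants `lam > 0`, `kap ≥ 0`, uniformly in `t`,
tested on smooth compactly supported functions (dense in `W^{1,2}(ℝⁿ;ℂᵐ)`). -/
def Garding (A : Pt n → (Grad n m →L[ℂ] Grad n m)) (lam kap : ℝ) : Prop :=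
  ∀ t : ℝ, ∀ v : Spc n → Val m, ContDiff ℝ (⊤:ℕ∞) v → HasCompactSupport v →
    lam * (∫ x, gnorm (tgradx v x) ^ 2) - kap * (∫ x, vnorm (v x) ^ 2)
      ≤ (∫ x, gdot (A (t, x) (tgradx v x)) (tgradx v x)).re

/-- `u` (with weak spatial gradient `Du`) is a weak solution of
`∂_t u − div A ∇u = f + div F` on `Ω`. -/
def IsWeakSol (Ω : Set (Pt n)) (A : Pt n → (Grad n m →L[ℂ] Grad n m))
    (u : Pt n → Val m) (Du : Pt n → Grad n m)
    (f : Pt n → Val m) (F : Pt n → Grad n m) : Prop :=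
  IsWeakGrad Ω u Du ∧
  ∀ φ : Pt n → Val m, IsTest Ω φ →
    (∫ z in Ω, gdot (A z (Du z)) (tgrad φ z)) - (∫ z in Ω, vdot (u z) (tdt φ z))
      = (∫ z in Ω, vdot (f z) (φ z)) - (∫ z in Ω, gdot (F z) (tgrad φ z))

/-- Local `L^p` integrability (of a scalar magnitude function) on `Ω`. -/
def MemLocP (Ω : Set (Pt n)) (g : Pt n → ℝ) (p : ℝ) : Prop :=
  ∀ K : Set (Pt n), IsCompact K → K ⊆ Ω → IntegrableOn (fun z => |g z| ^ p) K

/-- The open interval of length `ℓ` centered at `t₀`. -/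
def tIv (t₀ ℓ : ℝ) : Set ℝ := Set.Ioo (t₀ - ℓ/2) (t₀ + ℓ/2)

/-- The open parabolic cylinder `I × Q` with `I` centered at `t₀` of length `ℓ` and
`Q` the ball of radius `r` centered at `x₀`. -/
def cylinder (t₀ : ℝ) (x₀ : Spc n) (ℓ r : ℝ) : Set (Pt n) :=
  tIv t₀ ℓ ×ˢ Metric.ball x₀ r

/-- Lower parabolic Sobolev conjugate: `1/p_* = 1/p + 1/(n+2)`. -/
def pLow (p : ℝ) (n : ℕ) : ℝ := (p⁻¹ + ((n : ℝ) + 2)⁻¹)⁻¹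

/-- Upper parabolic Sobolev conjugate: `1/p* = 1/p − 1/(n+2)`. -/
def pUp (p : ℝ) (n : ℕ) : ℝ := (p⁻¹ - ((n : ℝ) + 2)⁻¹)⁻¹

/-- `D_t^{1/2} φ` for a nice function of one (time) variable, via the Fourier
symbol `|τ|^{1/2}`. -/
def halfDerivTest (φ : ℝ → ℂ) : ℝ → ℂ :=
  𝓕⁻ (fun τ : ℝ => (Real.sqrt |τ| : ℂ) * 𝓕 φ τ)

/-- `H_t φ` for a nice function of one (time) variable, via the Fourier symbol `i sgn τ`. -/
def hilbertTest (φ : ℝ → ℂ) : ℝ → ℂ :=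
  𝓕⁻ (fun τ : ℝ => Complex.I * (Real.sign τ : ℂ) * 𝓕 φ τ)

/-- `D` is the half-order time derivative `D_t^{1/2} v`, in the sense of duality with
test functions in the time variable (the symbol `|τ|^{1/2}` is even, so `D_t^{1/2}` is
symmetric for the bilinear pairing). -/
def IsHalfTimeDeriv (v D : Pt n → Val m) : Prop :=
  ∀ φ : ℝ → ℂ, ContDiff ℝ (⊤:ℕ∞) φ → HasCompactSupport φ → ∀ α : Fin m,
    ∀ᵐ x : Spc n, ∫ t, D (t, x) α * φ t = ∫ t, v (t, x) α * halfDerivTest φ t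

/-- `H` is the Hilbert transform `H_t v` in the time variable, in the sense of duality
(`H_t` is skew-symmetric for the bilinear pairing). -/
def IsHilbertPair (v H : Pt n → Val m) : Prop :=
  ∀ φ : ℝ → ℂ, ContDiff ℝ (⊤:ℕ∞) φ → HasCompactSupport φ → ∀ α : Fin m,
    ∀ᵐ x : Spc n, ∫ t, H (t, x) α * φ t = - ∫ t, v (t, x) α * hilbertTest φ t

/-- `D_t^{1/2} φ` of a smooth compactly supported function on space-time,
computed slice-wise in the time variable. -/
def halfDerivFun (φ : Pt n → ℂ) : Pt n → ℂ :=
  fun z => 𝓕⁻ (fun τ : ℝ => (Real.sqrt |τ| : ℂ) * 𝓕 (fun s => φ (s, z.2)) τ) z.1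

/-- Absolute continuity (on all of `ℝ`) of a real function. -/
def AbsCont (g : ℝ → ℝ) : Prop :=
  ∀ ε > (0:ℝ), ∃ δ > (0:ℝ), ∀ (s : Finset ℕ) (a b : ℕ → ℝ),
    (∀ i ∈ s, a i ≤ b i) →
    ((s : Set ℕ).PairwiseDisjoint fun i => Set.Ioo (a i) (b i)) →
    (∑ i ∈ s, (b i - a i)) < δ → (∑ i ∈ s, |g (b i) - g (a i)|) < ε

/-- The cut-off `χ • u`. -/
def locU (χ : Pt n → ℂ) (u : Pt n → Val m) : Pt n → Val m := fun z α => χ z * u z α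

/-- The gradient of `χ u`: `χ ∇u + u ⊗ ∇χ`. -/
def locGrad (χ : Pt n → ℂ) (u : Pt n → Val m) (Du : Pt n → Grad n m) : Pt n → Grad n m :=
  fun z i α => χ z * Du z i α + u z α * tdx χ i z

/-- The right-hand side `f̃ = χ f + (∂_t χ) u − A ∇u · ∇χ − F · ∇χ` appearing after
localization. -/
def locf (A : Pt n → (Grad n m →L[ℂ] Grad n m)) (χ : Pt n → ℂ)
    (u : Pt n → Val m) (Du : Pt n → Grad n m)
    (f : Pt n → Val m) (F : Pt n → Grad n m) : Pt n → Val m :=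
  fun z α => χ z * f z α + tdtc χ z * u z α
    - (∑ i, A z (Du z) i α * tdx χ i z) - (∑ i, F z i α * tdx χ i z)

/-- The right-hand side `F̃ = −A(u ∇χ) + F χ` appearing after localization. -/
def locF (A : Pt n → (Grad n m →L[ℂ] Grad n m)) (χ : Pt n → ℂ)
    (u : Pt n → Val m) (F : Pt n → Grad n m) : Pt n → Grad n m :=
  fun z i α => - A z (fun j β => u z β * tdx χ j z) i α + F z i α * χ z

/-- The tail functional `a_u(B) = Σ_j 2^{-j-1} ⨍⨍_{4^j I × γ Q} u`. -/
def tailAvg (γ : ℝ) (u : Pt n → ℝ) (t₀ : ℝ) (x₀ : Spc n) (r : ℝ) : ℝ :=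
  ∑' j : ℕ, ((2:ℝ)⁻¹) ^ (j+1) * ⨍ z in cylinder t₀ x₀ ((4:ℝ)^j * r^2) (γ * r), u z

/-- An element of the space `E_p = L^p(ℝ;W^{1,p}) ∩ H^{1/2,p}(ℝ;L^p)`: a function
together with its weak spatial gradient, half-order time derivative, and the Hilbert
transform in time of the latter, all `p`-integrable. -/
structure EpElem (n m : ℕ) (p : ℝ) where
  u : Pt n → Val m
  Du : Pt n → Grad n m
  Dh : Pt n → Val m
  HDh : Pt n → Val m
  grad : IsWeakGrad Set.univ u Du
  half : IsHalfTimeDeriv u Dh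
  hilb : IsHilbertPair Dh HDh
  memu : Integrable (fun z => vnorm (u z) ^ p)
  memDu : Integrable (fun z => gnorm (Du z) ^ p)
  memDh : Integrable (fun z => vnorm (Dh z) ^ p)

/-- The `E_p` norm. -/
def EnormP (p : ℝ) (U : EpElem n m p) : ℝ :=
  ((∫ z, vnorm (U.u z) ^ p) + (∫ z, gnorm (U.Du z) ^ p) + (∫ z, vnorm (U.Dh z) ^ p)) ^ (1/p)

/-- The sesquilinear form of `𝓛 = ∂_t − div A ∇ + κ + 1` on `E_p × E_q`. -/
def LformP {p q : ℝ} (A : Pt n → (Grad n m →L[ℂ] Grad n m)) (kap : ℝ)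
    (U : EpElem n m p) (V : EpElem n m q) : ℂ :=
  ∫ z, gdot (A z (U.Du z)) (V.Du z) + vdot (U.HDh z) (V.Dh z)
    + ((kap + 1 : ℝ) : ℂ) * vdot (U.u z) (V.u z)

/-- The action `⟨𝓛 U, φ⟩` on a smooth compactly supported test function `φ`. -/
def LformTest (A : Pt n → (Grad n m →L[ℂ] Grad n m)) (kap : ℝ)
    (u : Pt n → Val m) (Du : Pt n → Grad n m) (HDh : Pt n → Val m)
    (φ : Pt n → Val m) : ℂ :=
  ∫ z, gdot (A z (Du z)) (tgrad φ z)
    + vdot (HDh z) (fun α => halfDerivFun (fun w => φ w α) z)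
    + ((kap + 1 : ℝ) : ℂ) * vdot (u z) (φ z)


/-- The `L^p(ℝ^{n+1})` norm (valued in `ℝ≥0∞`) of a scalar magnitude function. -/
def pnormE (g : Pt n → ℝ) (p : ℝ) : ℝ≥0∞ := eLpNorm g (ENNReal.ofReal p) volume

/-- The mixed norm `‖H‖_{L^{qa}(ℝ; L^{qb}(ℝⁿ))}`, valued in `ℝ≥0∞`. -/
def mixedNorm (H : Pt n → ℝ) (qa qb : ℝ) : ℝ≥0∞ :=
  (∫⁻ t : ℝ, ((∫⁻ x : Spc n, ENNReal.ofReal |H (t, x)| ^ qb) ^ (1/qb)) ^ qa) ^ (1/qa)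


/-- The `ℝ≥0∞`-valued `L^p` average `(⨍⨍_S |g|^p)^{1/p}` over a set of space-time. -/
def avgP (S : Set (Pt n)) (g : Pt n → ℝ) (p : ℝ) : ℝ≥0∞ :=
  (⨍⁻ z in S, ENNReal.ofReal (|g z| ^ p) ∂volume) ^ (1/p)

/-- The `ℝ≥0∞`-valued `L^p` average `(⨍_S |g|^p)^{1/p}` over a set of space. -/
def avgPx {n : ℕ} (S : Set (Spc n)) (g : Spc n → ℝ) (p : ℝ) : ℝ≥0∞ :=
  (⨍⁻ x in S, ENNReal.ofReal (|g x| ^ p) ∂volume) ^ (1/p)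

end

noncomputable section PSMax

variable {E : Type*} [NormedAddCommGroup E] [NormedSpace ℝ E] [FiniteDimensional ℝ E]
  [MeasureSpace E] [BorelSpace E] [(volume : Measure E).IsAddHaarMeasure]

lemma ps_lintegral_affine (f : E → ℝ≥0∞) (hf : Measurable f) (x : E) {r : ℝ} (hr : 0 < r) :
    ∫⁻ y, f (x + r • y) = ENNReal.ofReal ((r ^ Module.finrank ℝ E)⁻¹) * ∫⁻ y, f y := by
  have h1 : ∫⁻ y, f (x + r • y) = ∫⁻ y, f (x + y) ∂(Measure.map (fun y : E => r • y) volume) := by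
    rw [lintegral_map (f := fun y => f (x + y)) (hf.comp (measurable_const_add x)) (measurable_const_smul r)]
  rw [h1, Measure.map_addHaar_smul _ hr.ne', lintegral_smul_measure,
    lintegral_add_left_eq_self, abs_of_pos (by positivity), smul_eq_mul]

/-- (unnormalised) average over the ball of radius `r`. -/
def psAvg (r : ℝ) (f : E → ℝ≥0∞) (x : E) : ℝ≥0∞ :=
  ∫⁻ y in closedBall (0:E) 1, f (x + r • y)

/-- dyadic maximal function -/
def psMax (f : E → ℝ≥0∞) (x : E) : ℝ≥0∞ := ⨆ k : ℤ, psAvg ((2:ℝ)^k) f x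

lemma ps_avg_eq (f : E → ℝ≥0∞) (hf : Measurable f) (x : E) {r : ℝ} (hr : 0 < r) :
    psAvg r f x = ENNReal.ofReal ((r ^ Module.finrank ℝ E)⁻¹) * ∫⁻ y in closedBall x r, f y := by
  unfold psAvg
  rw [← lintegral_indicator measurableSet_closedBall, ← lintegral_indicator measurableSet_closedBall,
    ← ps_lintegral_affine _ (hf.indicator measurableSet_closedBall) x hr]
  congr 1
  ext y
  simp only [indicator, mem_closedBall, dist_self_add_left, dist_zero_right, norm_smul,
    Real.norm_eq_abs, abs_of_pos hr]
  have : r * ‖y‖ ≤ r ↔ ‖y‖ ≤ 1 := by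
    constructor
    · intro h; nlinarith
    · intro h; nlinarith
  simp [this]

lemma ps_measurable_avg (r : ℝ) (f : E → ℝ≥0∞) (hf : Measurable f) : Measurable (psAvg r f) := by
  unfold psAvg
  apply Measurable.lintegral_prod_right'
    (f := fun z : E × E => f (z.1 + r • z.2))
  exact hf.comp (by fun_prop)

lemma ps_measurable_max (f : E → ℝ≥0∞) (hf : Measurable f) : Measurable (psMax f) :=
  Measurable.iSup fun _ => ps_measurable_avg _ f hf

lemma ps_weak : ∃ C : ℝ≥0∞, C ≠ ∞ ∧ ∀ f : E → ℝ≥0∞, Measurable f → ∀ l : ℝ≥0∞,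
    l * volume {x | l < psMax f x} ≤ C * ∫⁻ y, f y := by
  set d := Module.finrank ℝ E
  set B := volume (ball (0:E) 1)
  refine ⟨ENNReal.ofReal (5 ^ d) * B, ENNReal.mul_ne_top (by simp) measure_ball_lt_top.ne, ?_⟩
  intro f hf l
  set S : ℕ → Set E := fun K => {x | ∃ k : ℤ, k ≤ K ∧ l < psAvg ((2:ℝ)^k) f x}
  have hS : {x | l < psMax f x} = ⋃ K, S K := by
    ext x
    simp only [psMax, lt_iSup_iff, mem_ofPred_eq, mem_iUnion, S]
    constructor
    · rintro ⟨k, hk⟩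
      exact ⟨k.toNat, k, Int.self_le_toNat k, hk⟩
    · rintro ⟨K, k, _, hk⟩
      exact ⟨k, hk⟩
  have hmono : Monotone S := by
    intro a b hab x hx
    obtain ⟨k, hk, h⟩ := hx
    exact ⟨k, hk.trans (by exact_mod_cast hab), h⟩
  rw [hS, hmono.directed_le.measure_iUnion, ENNReal.mul_iSup]
  refine iSup_le fun K => ?_
  choose! k hkK hk using (fun x (hx : x ∈ S K) => hx)
  obtain ⟨u, huS, hud, hcov⟩ := Vitali.exists_disjoint_subfamily_covering_enlargement_closedBall
    (S K) (fun x => x) (fun x => (2:ℝ)^(k x)) ((2:ℝ)^(K:ℤ))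
    (fun a ha => zpow_le_zpow_right₀ (by norm_num) (hkK a ha)) 5 (by norm_num)
  have hcount : u.Countable := hud.countable_of_nonempty_interior (by
    intro i _
    refine ⟨i, ?_⟩
    have : ball i ((2:ℝ)^(k i)) ⊆ interior (closedBall i ((2:ℝ)^(k i))) := ball_subset_interior_closedBall
    exact this (mem_ball_self (by positivity)))
  have hsub : S K ⊆ ⋃ b ∈ u, closedBall b (5 * (2:ℝ)^(k b)) := by
    intro x hx
    obtain ⟨b, hb, hb'⟩ := hcov x hx
    simp only [mem_iUnion]
    exact ⟨b, hb, hb' (mem_closedBall_self (by positivity))⟩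
  calc l * volume (S K) ≤ l * ∑' b : u, volume (closedBall (b:E) (5 * (2:ℝ)^(k b))) := by
        gcongr
        exact (measure_mono hsub).trans (measure_biUnion_le _ hcount _)
    _ = ∑' b : u, l * volume (closedBall (b:E) (5 * (2:ℝ)^(k b))) := by rw [ENNReal.tsum_mul_left]
    _ ≤ ∑' b : u, ENNReal.ofReal (5 ^ d) * B * ∫⁻ y in closedBall (b:E) ((2:ℝ)^(k b)), f y := by
        refine ENNReal.tsum_le_tsum fun b => ?_
        have h1 := (hk b (huS b.2)).le
        have hr : (0:ℝ) < (2:ℝ)^(k b) := by positivity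
        rw [ps_avg_eq f hf _ hr] at h1
        rw [Measure.addHaar_closedBall _ _ (by positivity), mul_pow, ENNReal.ofReal_mul (by positivity)]
        calc _ ≤ (ENNReal.ofReal ((((2:ℝ)^(k b)) ^ d)⁻¹) * ∫⁻ y in closedBall (b:E) ((2:ℝ)^(k b)), f y) *
              (ENNReal.ofReal (5 ^ d) * ENNReal.ofReal (((2:ℝ)^(k b)) ^ d) * B) := by gcongr
          _ = (ENNReal.ofReal ((((2:ℝ)^(k b)) ^ d)⁻¹) * ENNReal.ofReal (((2:ℝ)^(k b)) ^ d)) *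
              (ENNReal.ofReal (5 ^ d) * B * ∫⁻ y in closedBall (b:E) ((2:ℝ)^(k b)), f y) := by ring
          _ = _ := by
            rw [← ENNReal.ofReal_mul (by positivity), inv_mul_cancel₀ (by positivity)]
            simp
    _ = ENNReal.ofReal (5 ^ d) * B * ∫⁻ y in ⋃ b ∈ u, closedBall (b:E) ((2:ℝ)^(k b)), f y := by
        rw [ENNReal.tsum_mul_left, lintegral_biUnion hcount (fun _ _ => measurableSet_closedBall) hud]
    _ ≤ _ := by gcongr; exact Measure.restrict_le_self

lemma ps_layer {p : ℝ} (hp : 0 < p) (a : ℝ≥0∞) :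
    a ^ p = ∫⁻ l in Ioi (0:ℝ), ENNReal.ofReal (p * l ^ (p - 1)) *
      (if ENNReal.ofReal l < a then 1 else 0) := by
  have key : ∀ b : ℝ, 0 ≤ b → ∫⁻ l in Ioo (0:ℝ) b, ENNReal.ofReal (p * l ^ (p - 1))
      = ENNReal.ofReal b ^ p := by
    intro b hb
    rw [restrict_Ioo_eq_restrict_Ioc, ← ofReal_integral_eq_lintegral_ofReal]
    · rw [← intervalIntegral.integral_of_le hb, intervalIntegral.integral_const_mul,
        integral_rpow (Or.inl (by linarith))]
      rw [ENNReal.ofReal_rpow_of_nonneg hb hp.le]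
      congr 1
      rw [Real.zero_rpow (by linarith)]
      simp
      field_simp
    · have := (intervalIntegral.intervalIntegrable_rpow' (a := 0) (b := b)
        (r := p - 1) (by linarith)).const_mul p
      rwa [intervalIntegrable_iff_integrableOn_Ioc_of_le hb] at this
    · filter_upwards [self_mem_ae_restrict measurableSet_Ioc] with l hl
      have := hl.1.le
      simp only [Pi.zero_apply]
      positivity
  rcases eq_or_ne a ∞ with rfl | ha
  · symm
    simp only [ENNReal.ofReal_lt_top, if_true, mul_one]
    rw [ENNReal.top_rpow_of_pos hp, eq_top_iff]
    refine ENNReal.le_of_forall_nnreal_lt fun c _ => ?_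
    have h1 := key ((c:ℝ) ^ (1/p)) (by positivity)
    rw [ENNReal.ofReal_rpow_of_nonneg (by positivity) hp.le, ← Real.rpow_mul (by positivity)] at h1
    simp only [one_div, inv_mul_cancel₀ hp.ne', Real.rpow_one, ENNReal.ofReal_coe_nnreal] at h1
    rw [← h1]
    exact lintegral_mono_set Ioo_subset_Ioi_self
  · lift a to ℝ≥0 using ha
    have h1 := key a a.2
    rw [ENNReal.ofReal_coe_nnreal] at h1
    rw [← h1, ← lintegral_indicator measurableSet_Ioo, ← lintegral_indicator measurableSet_Ioi]
    congr 1
    ext l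
    by_cases hl : 0 < l
    · have : ENNReal.ofReal l < (a:ℝ≥0∞) ↔ l < a := by
        rw [← ENNReal.ofReal_coe_nnreal, ENNReal.ofReal_lt_ofReal_iff_of_nonneg hl.le]
      simp [indicator, hl, this]
    · simp [indicator, hl]

lemma ps_layer_lintegral {α : Type*} [MeasureSpace α] [SFinite (volume : Measure α)] {p : ℝ} (hp : 0 < p) (F : α → ℝ≥0∞) (hF : Measurable F) :
    ∫⁻ x, F x ^ p = ∫⁻ l in Ioi (0:ℝ), ENNReal.ofReal (p * l ^ (p - 1)) *
      volume {x | ENNReal.ofReal l < F x} := by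
  simp_rw [ps_layer hp]
  rw [lintegral_lintegral_swap]
  · congr 1
    ext l
    rw [lintegral_const_mul' _ _ (by simp)]
    congr 1
    rw [← lintegral_indicator_one (measurableSet_lt measurable_const hF)]
    congr 1
    ext x
    simp [indicator]
  · apply Measurable.aemeasurable
    apply Measurable.mul
    · fun_prop
    · apply Measurable.ite _ measurable_const measurable_const
      exact measurableSet_lt (by fun_prop) (by fun_prop)

lemma ps_max_add (f : E → ℝ≥0∞) (hf : Measurable f) (l : ℝ≥0∞) (x : E) :
    psMax f x ≤ psMax (fun y => if l < f y then f y else 0) x + l * volume (closedBall (0:E) 1) := by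
  refine iSup_le fun k => ?_
  calc psAvg ((2:ℝ)^k) f x ≤ psAvg ((2:ℝ)^k) (fun y => if l < f y then f y else 0) x
        + l * volume (closedBall (0:E) 1) := by
        unfold psAvg
        rw [← setLIntegral_const, ← lintegral_add_right _ measurable_const]
        refine lintegral_mono fun y => ?_
        dsimp only
        split_ifs with h
        · exact le_self_add
        · simpa using h
    _ ≤ _ := by
        gcongr
        exact le_iSup (fun k : ℤ => psAvg ((2:ℝ)^k) (fun y => if l < f y then f y else 0) x) k

lemma ps_strong {p : ℝ} (hp : 1 < p) : ∃ C : ℝ≥0∞, C ≠ ∞ ∧ ∀ f : E → ℝ≥0∞, Measurable f →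
    ∫⁻ x, psMax f x ^ p ≤ C * ∫⁻ x, f x ^ p := by
  obtain ⟨C, hC, hw⟩ := ps_weak (E := E)
  set B := (volume (closedBall (0:E) 1)).toReal
  have hBpos : 0 < B := ENNReal.toReal_pos (measure_closedBall_pos _ _ one_pos).ne' measure_closedBall_lt_top.ne
  have hB : volume (closedBall (0:E) 1) = ENNReal.ofReal B :=
    (ENNReal.ofReal_toReal measure_closedBall_lt_top.ne).symm
  set c : ℝ := (2 * B)⁻¹
  have hc : 0 < c := by positivity
  refine ⟨C * ENNReal.ofReal (2 * p / (p-1) * c⁻¹ ^ (p-1)), ENNReal.mul_ne_top hC (by simp), fun f hf => ?_⟩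
  rw [ps_layer_lintegral (by linarith) _ (ps_measurable_max f hf)]
  have step : ∀ l ∈ Ioi (0:ℝ), ENNReal.ofReal (p * l ^ (p - 1)) * volume {x | ENNReal.ofReal l < psMax f x}
      ≤ ENNReal.ofReal (2 * p * l ^ (p-2)) * (C * ∫⁻ y, if ENNReal.ofReal (c * l) < f y then f y else 0) := by
    intro l hl
    have hl : 0 < l := hl
    have h1 : volume {x | ENNReal.ofReal l < psMax f x} ≤ volume {x | ENNReal.ofReal (l/2) <
        psMax (fun y => if ENNReal.ofReal (c*l) < f y then f y else 0) x} := by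
      apply measure_mono
      intro x hx
      simp only [mem_ofPred_eq] at hx ⊢
      by_contra hcon
      push Not at hcon
      have := ps_max_add f hf (ENNReal.ofReal (c*l)) x
      rw [hB, ← ENNReal.ofReal_mul (by positivity)] at this
      have h3 := (hx.trans_le this).trans_le (add_le_add_left hcon _)
      rw [← ENNReal.ofReal_add (by positivity) (by positivity)] at h3
      have : l / 2 + c * l * B = l := by simp only [c]; field_simp; norm_num
      rw [this] at h3
      exact lt_irrefl _ h3
    have h2 := hw (fun y => if ENNReal.ofReal (c*l) < f y then f y else 0)
      (Measurable.ite (measurableSet_lt measurable_const hf) hf measurable_const) (ENNReal.ofReal (l/2))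
    have h3 : ENNReal.ofReal (p * l ^ (p - 1)) = ENNReal.ofReal (2 * p * l ^ (p-2)) * ENNReal.ofReal (l/2) := by
      rw [← ENNReal.ofReal_mul (by positivity)]
      congr 1
      have : l ^ (p-1) = l ^ (p-2) * l := by
        rw [← Real.rpow_add_one hl.ne']; congr 1; ring
      rw [this]; ring
    rw [h3, mul_assoc]
    exact mul_le_mul_right ((mul_le_mul_right h1 _).trans h2) _
  refine (setLIntegral_mono' measurableSet_Ioi step).trans ?_
  have e1 : ∀ l : ℝ, ENNReal.ofReal (2 * p * l ^ (p-2)) * (C * ∫⁻ y, if ENNReal.ofReal (c * l) < f y then f y else 0)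
     = C * ∫⁻ y, ENNReal.ofReal (2 * p * l ^ (p-2)) * (if ENNReal.ofReal (c * l) < f y then f y else 0) := by
    intro l
    rw [lintegral_const_mul' _ _ (by simp)]; ring
  simp_rw [e1]
  rw [lintegral_const_mul' _ _ hC, mul_assoc]
  gcongr
  rw [← lintegral_const_mul' _ _ (by simp), lintegral_lintegral_swap]
  · refine lintegral_mono fun y => le_of_eq ?_
    have e2 : ∀ l ∈ Ioi (0:ℝ), ENNReal.ofReal (2 * p * l ^ (p-2)) * (if ENNReal.ofReal (c * l) < f y then f y else 0)
        = (ENNReal.ofReal (2 * p / (p-1)) * f y) * (ENNReal.ofReal ((p-1) * l ^ (p-1-1)) * (if ENNReal.ofReal l < ENNReal.ofReal c⁻¹ * f y then 1 else 0)) := by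
      intro l hl
      have hl : 0 < l := hl
      have h3 : ENNReal.ofReal (2 * p * l ^ (p-2)) = ENNReal.ofReal (2 * p / (p-1)) * ENNReal.ofReal ((p-1) * l ^ (p-1-1)) := by
        have : 0 < p - 1 := by linarith
        rw [← ENNReal.ofReal_mul (by positivity)]
        congr 1
        rw [show p - 1 - 1 = p - 2 by ring]
        field_simp
      have h4 : ENNReal.ofReal (c * l) < f y ↔ ENNReal.ofReal l < ENNReal.ofReal c⁻¹ * f y := by
        have hh : ENNReal.ofReal l = ENNReal.ofReal c⁻¹ * ENNReal.ofReal (c*l) := by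
          rw [← ENNReal.ofReal_mul (by positivity)]; congr 1; field_simp
        rw [hh]
        rw [ENNReal.mul_lt_mul_iff_right (by simpa using hc) (by simp)]
      rw [h3]
      by_cases h : ENNReal.ofReal (c * l) < f y
      · rw [if_pos h, if_pos (h4.1 h)]; ring
      · rw [if_neg h, if_neg (h4.not.1 h)]; ring
    rw [setLIntegral_congr_fun measurableSet_Ioi e2]
    rw [lintegral_const_mul _ (by
      apply Measurable.mul
      · fun_prop
      · apply Measurable.ite _ measurable_const measurable_const
        exact measurableSet_lt (by fun_prop) (by fun_prop)), ← ps_layer (by linarith)]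
    rw [ENNReal.mul_rpow_of_nonneg _ _ (by linarith), ENNReal.ofReal_mul (by have : 0 < p - 1 := by linarith
                                                                             positivity),
      ENNReal.ofReal_rpow_of_nonneg (by positivity) (by linarith)]
    have : f y ^ p = f y * f y ^ (p-1) := by
      conv_lhs => rw [show p = 1 + (p-1) by ring]
      rw [ENNReal.rpow_add_of_nonneg _ _ (by norm_num) (by linarith), ENNReal.rpow_one]
    rw [this]; ring
  · apply Measurable.aemeasurable
    apply Measurable.mul
    · fun_prop
    · apply Measurable.ite _ (by fun_prop) measurable_const
      exact measurableSet_lt (by fun_prop) (by fun_prop)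

end PSMax

noncomputable section PSFourier

lemma ps_fourierInv (h : ℝ → ℂ) (t : ℝ) :
    𝓕⁻ h t = ∫ τ : ℝ, Complex.exp (2 * π * t * τ * I) * h τ := by
  rw [Real.fourierInv_eq']
  congr 1
  ext τ
  simp [mul_assoc]

lemma ps_fourier (h : ℝ → ℂ) (t : ℝ) :
    𝓕 h t = ∫ v : ℝ, Complex.exp (-(2 * π * v * t * I)) * h v := by
  rw [Real.fourier_eq']
  congr 1
  ext τ
  simp
  left
  congr 1
  ring

lemma ps_norm_exp (x : ℝ) : ‖Complex.exp (2 * π * x * I)‖ = 1 := by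
  have : (2 * π * x * I : ℂ) = ((2 * π * x : ℝ) : ℂ) * I := by push_cast; ring
  rw [this, Complex.norm_exp_ofReal_mul_I]

lemma ps_conv {κ h : ℝ → ℂ} (hκ : Integrable κ) (hh : Integrable h) (t s : ℝ) :
    ∫ v, κ v * 𝓕⁻ h (t - s * v) = 𝓕⁻ (fun τ => 𝓕 κ (s * τ) * h τ) t := by
  simp_rw [ps_fourierInv, ps_fourier]
  have e1 : ∀ v : ℝ, κ v * ∫ τ : ℝ, Complex.exp (2 * π * (t - s * v : ℝ) * τ * I) * h τ
      = ∫ τ : ℝ, κ v * (Complex.exp (2 * π * (t - s * v : ℝ) * τ * I) * h τ) := by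
    intro v; rw [integral_const_mul]
  simp_rw [e1]
  rw [integral_integral_swap]
  · congr 1
    ext τ
    rw [← integral_mul_const, ← integral_const_mul]
    congr 1
    ext v
    have : (2 * π * (t - s * v : ℝ) * τ * I : ℂ) = 2 * π * t * τ * I + -(2 * π * v * (s * τ : ℝ) * I) := by
      push_cast; ring
    rw [this, Complex.exp_add]; ring
  · have := hκ.mul_prod hh
    refine this.mono ?_ (Eventually.of_forall fun z => ?_)
    · apply AEStronglyMeasurable.congr (f := fun z : ℝ × ℝ => Complex.exp (2 * π * (t - s * z.1 : ℝ) * z.2 * I) * (κ z.1 * h z.2))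
      · exact (by fun_prop : Continuous fun z : ℝ × ℝ => Complex.exp (2 * π * (t - s * z.1 : ℝ) * z.2 * I)).aestronglyMeasurable.mul this.1
      · exact Eventually.of_forall fun z => by simp only [Function.uncurry]; ring
    · have := ps_norm_exp ((t - s * z.1) * z.2)
      simp only [Function.uncurry, norm_mul]
      rw [show (2 * π * (t - s * z.1 : ℝ) * z.2 * I : ℂ) = 2 * π * ((t - s * z.1) * z.2 : ℝ) * I by push_cast; ring, this]
      simp


lemma ps_integrable_abs {g : ℝ → ℂ} (hg : IntegrableOn g (Ioi 0)) :
    Integrable (fun x => g |x|) := by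
  rw [← integrableOn_univ, ← Iic_union_Ioi (a := (0:ℝ)), integrableOn_union]
  constructor
  · rw [integrableOn_Iic_iff_integrableOn_Iio]
    have h1 : IntegrableOn (fun x : ℝ => g (-x)) (Iio 0) := by
      have := (Measure.measurePreserving_neg (volume : Measure ℝ)).integrableOn_comp_preimage
        (Homeomorph.neg ℝ).measurableEmbedding (f := g) (s := Ioi 0)
      simpa [Function.comp_def] using this.2 hg
    refine h1.congr_fun (fun x hx => ?_) measurableSet_Iio
    simp only [abs_of_neg (show x < 0 from hx)]
  · refine hg.congr_fun (fun x hx => ?_) measurableSet_Ioi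
    simp only [abs_of_pos (show 0 < x from hx)]

lemma ps_fold {G : ℝ → ℂ} (hG : Integrable G) :
    ∫ x, G x = (∫ x in Ioi (0:ℝ), G x) + ∫ x in Ioi (0:ℝ), G (-x) := by
  rw [← intervalIntegral.integral_Iic_add_Ioi (b := 0) hG.integrableOn hG.integrableOn,
    integral_comp_neg_Ioi, neg_zero, add_comm]

lemma ps_fourierInv_abs {g : ℝ → ℂ} (hg : IntegrableOn g (Ioi 0)) (v : ℝ) :
    𝓕⁻ (fun τ : ℝ => g |τ|) v =
      (∫ τ in Ioi (0:ℝ), Complex.exp (2 * π * v * τ * I) * g τ) +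
      (∫ τ in Ioi (0:ℝ), Complex.exp (-(2 * π * v * τ * I)) * g τ) := by
  rw [ps_fourierInv, ps_fold]
  · congr 1
    · refine setIntegral_congr_fun measurableSet_Ioi fun x hx => ?_
      simp only [abs_of_pos (show 0 < x from hx)]
    · refine setIntegral_congr_fun measurableSet_Ioi fun x hx => ?_
      simp only [abs_neg, abs_of_pos (show 0 < x from hx)]
      congr 2
      push_cast; ring
  · refine (ps_integrable_abs hg).bdd_mul (c := 1) (by
      apply Continuous.aestronglyMeasurable; fun_prop) (Eventually.of_forall fun x => ?_)
    have := ps_norm_exp (v * x)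
    rw [show (2 * π * v * x * I : ℂ) = 2 * π * (v * x : ℝ) * I by push_cast; ring, this]

/-- Poisson kernel at height one. -/
def psPi (v : ℝ) : ℝ := (π * (1 + v^2))⁻¹

lemma ps_continuous_pi : Continuous psPi := by
  unfold psPi
  refine Continuous.inv₀ (by fun_prop) fun v => ?_
  positivity

lemma ps_pi_fourierInv : 𝓕⁻ (fun τ : ℝ => (Real.exp (-(2 * π * |τ|)) : ℂ)) = fun v => (psPi v : ℂ) := by
  have hintg : ∀ v : ℝ, IntegrableOn (fun x : ℝ => Complex.exp ((2 * π * (-1 + v * I)) * x)) (Ioi 0) := by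
    intro v
    apply integrableOn_exp_mul_complex_Ioi
    simp
    positivity
  have hval : ∀ v : ℝ, ∫ x : ℝ in Ioi 0, Complex.exp ((2 * π * (-1 + v * I)) * x) = 1 / (2 * π * (1 - v * I)) := by
    intro v
    rw [integral_exp_mul_complex_Ioi]
    · simp
      rw [show (-1 + v * I : ℂ) = -(1 - v * I) by ring, mul_neg, neg_div_neg_eq]
      simp only [one_div, mul_inv]; ring
    · simp
      positivity
  ext v
  have h0 : IntegrableOn (fun τ : ℝ => (Real.exp (-(2 * π * τ)) : ℂ)) (Ioi 0) := by
    refine (hintg 0).congr_fun (fun x _ => ?_) measurableSet_Ioi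
    simp
  rw [ps_fourierInv_abs h0 v]
  have h1 : ∀ x : ℝ, Complex.exp (2 * π * v * x * I) * (Real.exp (-(2 * π * x)) : ℂ) = Complex.exp ((2 * π * (-1 + v * I)) * x) := by
    intro x
    push_cast
    rw [← Complex.exp_add]; congr 1; ring
  have h2 : ∀ x : ℝ, Complex.exp (-(2 * π * v * x * I)) * (Real.exp (-(2 * π * x)) : ℂ) = Complex.exp ((2 * π * (-1 + (-v : ℝ) * I)) * x) := by
    intro x
    push_cast
    rw [← Complex.exp_add]; congr 1; ring
  simp_rw [h1, h2]
  rw [hval, hval]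
  unfold psPi
  have a1 : (1 - v * I : ℂ) ≠ 0 := by
    intro h
    have := congrArg Complex.re h
    simp at this
  have a2 : (1 + v * I : ℂ) ≠ 0 := by
    intro h
    have := congrArg Complex.re h
    simp at this
  have a3 : (1 + v^2 : ℂ) = (1 - v * I) * (1 + v * I) := by
    ring_nf; simp
  push_cast
  rw [a3]
  have : (π : ℂ) ≠ 0 := by exact_mod_cast Real.pi_ne_zero
  simp only [neg_mul, sub_neg_eq_add]
  field_simp
  ring

lemma ps_pi_integrable : Integrable psPi := by
  unfold psPi
  simp_rw [mul_inv]
  exact integrable_inv_one_add_sq.const_mul _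

lemma ps_pi_fourier (ω : ℝ) : 𝓕 (fun v => (psPi v : ℂ)) ω = (Real.exp (-(2 * π * |ω|)) : ℂ) := by
  rw [← ps_pi_fourierInv, Continuous.fourier_fourierInv_eq]
  · fun_prop
  · apply ps_integrable_abs (g := fun τ : ℝ => (Real.exp (-(2 * π * τ)) : ℂ))
    have : IntegrableOn (fun x : ℝ => Complex.exp ((2 * π * (-1 + (0:ℝ) * I)) * x)) (Ioi 0) := by
      apply integrableOn_exp_mul_complex_Ioi
      simp
      positivity
    refine this.congr_fun (fun x _ => ?_) measurableSet_Ioi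
    simp
  · have h2 := congrFun ps_pi_fourierInv
    have h3 : 𝓕 (fun τ : ℝ => (Real.exp (-(2 * π * |τ|)) : ℂ)) = fun v => (psPi v : ℂ) := by
      ext v
      have := h2 (-v)
      rw [ps_fourierInv] at this
      rw [ps_fourier]
      simp only [psPi, even_two, Even.neg_pow] at this ⊢
      rw [← this]
      congr 1
      ext x
      congr 2
      push_cast; ring
    rw [h3]
    exact ps_pi_integrable.ofReal

lemma ps_gauss_int {r : ℂ} (hr : 0 < r.re) :
    IntegrableOn (fun τ : ℝ => Complex.exp (-r * τ) * ((√τ)⁻¹ : ℝ)) (Ioi 0) := by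
  have h := (Real.GammaIntegral_convergent (s := 1/2) (by norm_num))
  have h2 : IntegrableOn (fun x : ℝ => x ^ (-(1/2) : ℝ) * Real.exp (- r.re * x)) (Ioi 0) := by
    have := integrableOn_rpow_mul_exp_neg_mul_rpow (s := -(1/2)) (p := 1) (b := r.re) (by norm_num) (by norm_num) hr
    simpa using this
  refine h2.mono' ?_ ?_
  · apply Measurable.aestronglyMeasurable
    fun_prop
  · filter_upwards [self_mem_ae_restrict measurableSet_Ioi] with x hx
    have hx : 0 < x := hx
    rw [norm_mul, Complex.norm_exp, Complex.norm_real, Real.rpow_neg hx.le, ← Real.sqrt_eq_rpow,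
      Real.norm_of_nonneg (by positivity)]
    simp [mul_comm]

lemma ps_gauss_val {r : ℂ} (hr : 0 < r.re) :
    ∫ τ : ℝ in Ioi 0, Complex.exp (-r * τ) * ((√τ)⁻¹ : ℝ) = (π / r) ^ (1/2 : ℂ) := by
  rw [← integral_comp_rpow_Ioi _ (p := 2) (by norm_num)]
  have := integral_gaussian_complex_Ioi hr
  have h2 : (π / r : ℂ) ^ (1/2 : ℂ) = 2 * ∫ x : ℝ in Ioi 0, Complex.exp (-r * x^2) := by
    rw [this]; ring
  rw [h2, ← integral_const_mul]
  refine setIntegral_congr_fun measurableSet_Ioi fun x hx => ?_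
  have hx : 0 < x := hx
  have hx' : (x:ℂ) ≠ 0 := by exact_mod_cast hx.ne'
  simp only [Real.rpow_two, Real.sqrt_sq hx.le]
  norm_num
  field_simp


/-- symbol of the kernel `psK`. -/
def psM (τ : ℝ) : ℝ := (Real.exp (-(2 * π * |τ|)) - Real.exp (-(8 * π * |τ|))) * (√|τ|)⁻¹

def psK : ℝ → ℂ := 𝓕⁻ (fun τ : ℝ => (psM τ : ℂ))

lemma ps_M_nonneg (τ : ℝ) : 0 ≤ psM τ := by
  unfold psM
  have : Real.exp (-(8 * π * |τ|)) ≤ Real.exp (-(2 * π * |τ|)) := by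
    apply Real.exp_le_exp.2
    have := abs_nonneg τ
    nlinarith [Real.pi_pos, mul_nonneg Real.pi_pos.le this]
  have : 0 ≤ Real.exp (-(2 * π * |τ|)) - Real.exp (-(8 * π * |τ|)) := by linarith
  positivity

lemma ps_M_le (τ : ℝ) : psM τ ≤ 8 * π * √|τ| := by
  unfold psM
  have h1 : Real.exp (-(2 * π * |τ|)) ≤ 1 := by
    apply Real.exp_le_one_iff.2
    have := abs_nonneg τ
    have := Real.pi_pos
    simp; positivity
  have h2 := Real.add_one_le_exp (-(8 * π * |τ|))
  rcases eq_or_ne τ 0 with rfl | h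
  · simp
  have : 0 < |τ| := abs_pos.2 h
  have hs : 0 < √|τ| := Real.sqrt_pos.2 this
  rw [← div_eq_mul_inv, div_le_iff₀ hs, mul_assoc (8 * π), Real.mul_self_sqrt this.le]
  linarith

lemma ps_M_continuous : Continuous psM := by
  rw [continuous_iff_continuousAt]
  intro τ
  rcases eq_or_ne τ 0 with rfl | h
  · have h0 : psM 0 = 0 := by simp [psM]
    rw [ContinuousAt, h0]
    have : Tendsto (fun τ : ℝ => 8 * π * √|τ|) (𝓝 0) (𝓝 0) := by
      have : Continuous (fun τ : ℝ => 8 * π * √|τ|) := by fun_prop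
      simpa using this.tendsto 0
    exact tendsto_of_tendsto_of_tendsto_of_le_of_le tendsto_const_nhds this ps_M_nonneg ps_M_le
  · unfold psM
    have : √|τ| ≠ 0 := (Real.sqrt_pos.2 (abs_pos.2 h)).ne'
    fun_prop (disch := assumption)

lemma ps_M_eq (τ : ℝ) (a : ℂ) : Complex.exp a * ((Real.exp (-(2 * π * τ)) - Real.exp (-(8 * π * τ))) * (√τ)⁻¹ : ℝ)
    = Complex.exp (a - 2 * π * τ) * ((√τ)⁻¹ : ℝ) - Complex.exp (a - 8 * π * τ) * ((√τ)⁻¹ : ℝ) := by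
  rw [Complex.exp_sub, Complex.exp_sub]
  push_cast
  rw [Complex.exp_neg, Complex.exp_neg]
  ring

def psA (c v : ℝ) : ℂ := (π / (2 * π * (c - v * I))) ^ (1/2 : ℂ)

lemma ps_re (c v : ℝ) (hc : 0 < c) : 0 < (2 * π * (c - v * I) : ℂ).re := by
  simp; positivity

lemma ps_M_intOn : IntegrableOn (fun τ : ℝ => (((Real.exp (-(2 * π * τ)) - Real.exp (-(8 * π * τ))) * (√τ)⁻¹ : ℝ) : ℂ)) (Ioi 0) := by
  have h1 := (ps_gauss_int (ps_re 1 0 one_pos)).sub (ps_gauss_int (ps_re 4 0 (by norm_num)))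
  refine h1.congr_fun (fun x _ => ?_) measurableSet_Ioi
  have := ps_M_eq x 0
  rw [Complex.exp_zero, one_mul] at this
  rw [this]
  simp only [Pi.sub_apply]
  congr 3
  · push_cast; ring
  · push_cast; ring

lemma ps_M_integrable : Integrable (fun τ : ℝ => (psM τ : ℂ)) := ps_integrable_abs ps_M_intOn

lemma ps_K_val (v : ℝ) : psK v = (psA 1 v - psA 4 v) + (psA 1 (-v) - psA 4 (-v)) := by
  unfold psK
  have := ps_fourierInv_abs ps_M_intOn v
  unfold psM
  rw [this]
  have key : ∀ v : ℝ, (∫ τ in Ioi (0:ℝ), Complex.exp (2 * π * v * τ * I) *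
      ((Real.exp (-(2 * π * τ)) - Real.exp (-(8 * π * τ))) * (√τ)⁻¹ : ℝ)) = psA 1 v - psA 4 v := by
    intro v
    unfold psA
    rw [← ps_gauss_val (ps_re 1 v one_pos), ← ps_gauss_val (ps_re 4 v (by norm_num)),
      ← integral_sub (ps_gauss_int (ps_re 1 v one_pos)) (ps_gauss_int (ps_re 4 v (by norm_num)))]
    congr 1
    ext τ
    rw [ps_M_eq]
    congr 3
    · push_cast; ring
    · push_cast; ring
  rw [key, ← key (-v)]
  congr 3
  ext τ
  congr 2
  push_cast; ring

lemma ps_A_sq (c v : ℝ) : psA c v ^ 2 = π / (2 * π * (c - v * I)) := by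
  unfold psA
  rw [← Complex.cpow_nat_mul]
  simp

lemma ps_A_re (c v : ℝ) (hc : 0 < c) : 0 ≤ (psA c v).re := by
  unfold psA
  have hne : (π / (2 * π * (c - v * I)) : ℂ) ≠ 0 := by
    have : (2 * π * (c - v * I) : ℂ) ≠ 0 := by
      intro h
      have h2 := ps_re c v hc
      rw [h] at h2
      simp at h2
    have : (π : ℂ) ≠ 0 := by exact_mod_cast Real.pi_ne_zero
    positivity
  rw [Complex.cpow_def_of_ne_zero hne, Complex.exp_re]
  apply mul_nonneg (Real.exp_pos _).le
  apply Real.cos_nonneg_of_mem_Icc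
  set z := (π / (2 * π * (c - v * I)) : ℂ)
  have : (Complex.log z * (1/2)).im = z.arg / 2 := by
    simp [Complex.log_im]; ring
  rw [this]
  have h1 := Complex.neg_pi_lt_arg z
  have h2 := Complex.arg_le_pi z
  constructor <;> linarith

lemma ps_diff_bound (A B : ℂ) (hA : 0 ≤ A.re) (hB : 0 ≤ B.re) (hA2 : 0 ≤ (A^2).re) :
    ‖A - B‖ * ‖A‖ ≤ √2 * ‖A^2 - B^2‖ := by
  have h1 : ‖A‖ ≤ √2 * ‖A + B‖ := by
    have h2 : A.im^2 ≤ A.re^2 := by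
      have : (A^2).re = A.re^2 - A.im^2 := by rw [sq A, Complex.mul_re]; ring
      linarith
    have h3 : A.re ≤ ‖A + B‖ := by
      have := Complex.re_le_norm (A+B)
      simp only [Complex.add_re] at this
      linarith
    have h4 : ‖A‖ = √(A.re^2 + A.im^2) := by
      rw [Complex.norm_def, Complex.normSq_apply]; congr 1; ring
    rw [h4]
    calc √(A.re^2 + A.im^2) ≤ √(2 * A.re^2) := Real.sqrt_le_sqrt (by linarith)
      _ = √2 * A.re := by rw [Real.sqrt_mul (by norm_num), Real.sqrt_sq hA]
      _ ≤ _ := by gcongr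
  calc ‖A - B‖ * ‖A‖ ≤ ‖A - B‖ * (√2 * ‖A + B‖) := by gcongr
    _ = √2 * ‖(A - B) * (A + B)‖ := by rw [norm_mul]; ring
    _ = _ := by congr 2; ring

/-- the weight -/
def psW (v : ℝ) : ℝ := (1 + |v|) ^ (-(3/2) : ℝ)

lemma ps_A_bound (v : ℝ) : ‖psA 1 v - psA 4 v‖ ≤ 90 * psW v := by
  set a : ℂ := 2 * π * ((1:ℝ) - v * I) with ha
  set b : ℂ := 2 * π * ((4:ℝ) - v * I) with hb
  have hare := ps_re 1 v one_pos
  have hbre := ps_re 4 v (by norm_num)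
  rw [← ha] at hare
  rw [← hb] at hbre
  have ha0 : a ≠ 0 := by rintro h; simp [h] at hare
  have hb0 : b ≠ 0 := by rintro h; simp [h] at hbre
  have hapos : 0 < ‖a‖ := norm_pos_iff.2 ha0
  have hA2 := ps_A_sq 1 v
  have hB2 := ps_A_sq 4 v
  rw [← ha] at hA2
  rw [← hb] at hB2
  have hr : 0 ≤ ((psA 1 v)^2).re := by
    rw [hA2, Complex.div_re]
    simp only [Complex.ofReal_im, Complex.ofReal_re, zero_mul, zero_div, add_zero]
    have := Complex.normSq_nonneg a
    have := Real.pi_pos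
    positivity
  have key := ps_diff_bound _ _ (ps_A_re 1 v one_pos) (ps_A_re 4 v (by norm_num)) hr
  have hna : ‖a‖ = 2 * π * √(1 + v^2) := by
    rw [ha, norm_mul, Complex.norm_def (_ - _), Complex.normSq_apply]
    simp [abs_of_pos Real.pi_pos]
    congr 1; ring
  have hnb : ‖b‖ = 2 * π * √(16 + v^2) := by
    rw [hb, norm_mul, Complex.norm_def (_ - _), Complex.normSq_apply]
    simp [abs_of_pos Real.pi_pos]
    congr 1; ring
  have hab : ‖a‖ ≤ ‖b‖ := by
    rw [hna, hnb]
    have := Real.pi_pos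
    gcongr; norm_num
  have hva : 1 + |v| ≤ ‖a‖ := by
    rw [hna]
    have h1 : 1 + |v| ≤ 2 * √(1+v^2) := by
      have : (1 + |v|)/2 ≤ √(1+v^2) := by
        apply Real.le_sqrt_of_sq_le
        have := sq_abs v
        nlinarith [abs_nonneg v, sq_nonneg (|v| - 1)]
      linarith
    have := Real.pi_gt_three
    have h3 := Real.sqrt_nonneg (1+v^2)
    nlinarith
  have hsq : ‖psA 1 v‖ ^ 2 = π / ‖a‖ := by
    rw [← norm_pow, hA2, norm_div, Complex.norm_real, Real.norm_of_nonneg Real.pi_pos.le]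
  have hAn : ‖psA 1 v‖ = √π / √‖a‖ := by
    rw [← Real.sqrt_div Real.pi_pos.le, ← hsq, Real.sqrt_sq (norm_nonneg _)]
  have hdiff : ‖psA 1 v ^ 2 - psA 4 v ^ 2‖ ≤ 6 * π^2 / (‖a‖ * ‖a‖) := by
    rw [hA2, hB2]
    have : (π / a - π / b : ℂ) = (6 * π^2 : ℝ) / (a * b) := by
      have : (b : ℂ) - a = 6 * π := by rw [ha, hb]; push_cast; ring
      rw [div_sub_div _ _ ha0 hb0]
      congr 1
      push_cast
      linear_combination (π:ℂ) * this
    rw [this, norm_div, norm_mul, Complex.norm_real, Real.norm_of_nonneg (by positivity)]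
    gcongr
  rw [hAn] at key
  have hsa : 0 < √‖a‖ := Real.sqrt_pos.2 hapos
  have hsp : 1 ≤ √π := by
    rw [Real.one_le_sqrt]; linarith [Real.pi_gt_three]
  have h2 : √2 ≤ 3/2 := by
    rw [Real.sqrt_le_left (by norm_num)]; norm_num
  have hw : psW v = ((1 + |v|) * √(1+|v|))⁻¹ := by
    unfold psW
    have : 0 < 1 + |v| := by positivity
    rw [Real.rpow_neg this.le, show (3/2:ℝ) = 1 + 1/2 by norm_num, Real.rpow_add this, Real.rpow_one, Real.sqrt_eq_rpow]
  have hpi2 : π ^ 2 ≤ 10 := by nlinarith [Real.pi_lt_d2, Real.pi_pos]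
  have h3 : ‖psA 1 v - psA 4 v‖ * (1 / √‖a‖) ≤ 3/2 * (60 / (‖a‖ * ‖a‖)) := by
    calc _ ≤ ‖psA 1 v - psA 4 v‖ * (√π / √‖a‖) := by gcongr
      _ ≤ _ := key
      _ ≤ 3/2 * (6 * π^2 / (‖a‖ * ‖a‖)) := by gcongr
      _ ≤ _ := by gcongr; linarith
  have step : ‖psA 1 v - psA 4 v‖ ≤ 90 * (‖a‖ * √‖a‖)⁻¹ := by
    calc ‖psA 1 v - psA 4 v‖ = ‖psA 1 v - psA 4 v‖ * (1 / √‖a‖) * √‖a‖ := by field_simp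
      _ ≤ 3/2 * (60 / (‖a‖ * ‖a‖)) * √‖a‖ := by gcongr
      _ = 3/2 * (60 / (‖a‖ * (√‖a‖ * √‖a‖))) * √‖a‖ := by rw [Real.mul_self_sqrt hapos.le]
      _ = _ := by field_simp; norm_num
  rw [hw]
  calc _ ≤ _ := step
    _ ≤ _ := by gcongr

lemma ps_K_bound (v : ℝ) : ‖psK v‖ ≤ 180 * psW v := by
  rw [ps_K_val]
  have h1 := ps_A_bound v
  have h2 := ps_A_bound (-v)
  have : psW (-v) = psW v := by simp [psW]
  rw [this] at h2
  have := norm_add_le (psA 1 v - psA 4 v) (psA 1 (-v) - psA 4 (-v))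
  linarith

lemma ps_W_pos (v : ℝ) : 0 < psW v := by unfold psW; positivity

lemma ps_W_continuous : Continuous psW := by
  unfold psW
  refine Continuous.rpow_const (by fun_prop) fun v => ?_
  left; positivity

lemma ps_W_integrable : Integrable psW := by
  have := integrable_one_add_norm (E := ℝ) (μ := volume) (r := 3/2) (by simp; norm_num)
  have e : psW = fun x : ℝ => (1 + ‖x‖) ^ (-(3/2) : ℝ) := by ext x; simp [psW]
  rw [e]; exact this

lemma ps_W_le_one (v : ℝ) : psW v ≤ 1 := by
  unfold psW
  apply Real.rpow_le_one_of_one_le_of_nonpos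
  · simp
  · norm_num

lemma ps_pi_bound (v : ℝ) : psPi v ≤ 180 * psW v := by
  have h0 : 0 < 1 + |v| := by positivity
  have h1 : psW v ≥ ((1 + |v|)^2)⁻¹ := by
    unfold psW
    rw [← Real.rpow_natCast, ← Real.rpow_neg h0.le]
    apply Real.rpow_le_rpow_of_exponent_le
    · simp
    · norm_num
  have h2 : psPi v ≤ 2 * ((1 + |v|)^2)⁻¹ := by
    unfold psPi
    rw [← one_div, ← div_eq_mul_inv, div_le_div_iff₀ (by positivity) (by positivity)]
    have := sq_abs v
    have := Real.pi_gt_three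
    nlinarith [abs_nonneg v, sq_nonneg (|v| - 1), sq_nonneg v]
  have : 0 < psW v := ps_W_pos v
  linarith

lemma ps_fourierInv_continuous {h : ℝ → ℂ} (hh : Integrable h) : Continuous (𝓕⁻ h) := by
  have e : 𝓕⁻ h = fun t : ℝ => ∫ τ : ℝ, Complex.exp (2 * π * t * τ * I) * h τ := by
    ext t; rw [ps_fourierInv]
  rw [e]
  refine continuous_of_dominated (bound := fun τ => ‖h τ‖) ?_ ?_ hh.norm ?_
  · intro t
    exact (by fun_prop : Continuous fun τ : ℝ => Complex.exp (2 * π * t * τ * I)).aestronglyMeasurable.mul hh.1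
  · intro t
    refine Eventually.of_forall fun τ => ?_
    rw [norm_mul, show (2 * π * t * τ * I : ℂ) = 2 * π * (t * τ : ℝ) * I by push_cast; ring, ps_norm_exp, one_mul]
  · refine Eventually.of_forall fun τ => ?_
    fun_prop

lemma ps_K_continuous : Continuous psK := by
  unfold psK
  exact ps_fourierInv_continuous ps_M_integrable

lemma ps_K_integrable : Integrable psK :=
  (ps_W_integrable.const_mul 180).mono' ps_K_continuous.aestronglyMeasurable
    (Eventually.of_forall ps_K_bound)

lemma ps_fourier_even {g : ℝ → ℂ} (hg : ∀ x, g (-x) = g x) : 𝓕 g = 𝓕⁻ g := by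
  ext v
  rw [ps_fourierInv, ps_fourier, ← integral_neg_eq_self]
  congr 1
  ext x
  rw [hg]
  congr 2
  push_cast; ring

lemma ps_K_fourier (ω : ℝ) : 𝓕 psK ω = psM ω := by
  unfold psK
  rw [Continuous.fourier_fourierInv_eq]
  · have := ps_M_continuous; fun_prop
  · exact ps_M_integrable
  · rw [ps_fourier_even (by simp [psM])]
    exact ps_K_integrable

/-- The key identity in the time variable. -/
lemma ps_time_identity {f : ℝ → ℂ} (hf : Continuous f) (hfi : Integrable f) (hF : Integrable (𝓕 f))
    (hH : Integrable (fun τ : ℝ => (√|τ| : ℂ) * 𝓕 f τ)) (t : ℝ) {s : ℝ} (hs : 0 < s) :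
    (∫ v, (psPi v : ℂ) * f (t - s * v)) - (∫ v, (psPi v : ℂ) * f (t - (4 * s) * v)) =
      (√s : ℂ) * ∫ v, psK v * 𝓕⁻ (fun τ : ℝ => (√|τ| : ℂ) * 𝓕 f τ) (t - s * v) := by
  have hinv : f = 𝓕⁻ (𝓕 f) := (hf.fourierInv_fourier_eq hfi hF).symm
  have h1 : ∀ s : ℝ, (∫ v, (psPi v : ℂ) * f (t - s * v)) =
      𝓕⁻ (fun τ => 𝓕 (fun v => (psPi v : ℂ)) (s * τ) * 𝓕 f τ) t := by
    intro s
    have := ps_conv (ps_pi_integrable.ofReal (𝕜 := ℂ)) hF t s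
    rw [← hinv] at this
    exact this
  rw [h1, h1, ps_conv ps_K_integrable hH]
  simp_rw [ps_pi_fourier, ps_K_fourier, ps_fourierInv]
  have hintg : ∀ s : ℝ, 0 < s → Integrable (fun τ : ℝ => Complex.exp (2 * π * t * τ * I) *
      ((Real.exp (-(2 * π * |s * τ|)) : ℂ) * 𝓕 f τ)) := by
    intro s hs
    simp_rw [← mul_assoc]
    refine hF.bdd_mul (c := 1) (by
      apply Continuous.aestronglyMeasurable; fun_prop) (Eventually.of_forall fun x => ?_)
    rw [norm_mul, show (2 * π * t * x * I : ℂ) = 2 * π * (t * x : ℝ) * I by push_cast; ring, ps_norm_exp,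
      one_mul, Complex.norm_real, Real.norm_of_nonneg (Real.exp_pos _).le]
    apply Real.exp_le_one_iff.2
    have := Real.pi_pos
    simp only [Left.neg_nonpos_iff]
    positivity
  rw [← integral_sub (hintg s hs) (hintg (4*s) (by positivity)), ← integral_const_mul]
  congr 1
  ext τ
  have : (√s : ℂ) * ((psM (s * τ) : ℂ) * √|τ|) = (Real.exp (-(2 * π * |s * τ|)) : ℂ) - (Real.exp (-(2 * π * |4 * s * τ|)) : ℂ) := by
    have h4 : |4 * s * τ| = 4 * |s * τ| := by rw [mul_assoc, abs_mul]; norm_num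
    rw [h4]
    rcases eq_or_ne τ 0 with rfl | h
    · simp
    have h2 : √|s * τ| = √s * √|τ| := by
      rw [abs_mul, abs_of_pos hs, Real.sqrt_mul hs.le]
    have h3 : √s * √|τ| ≠ 0 := by
      have := Real.sqrt_pos.2 (abs_pos.2 h)
      have := Real.sqrt_pos.2 hs
      positivity
    have : √s * (psM (s * τ) * √|τ|) = Real.exp (-(2 * π * |s * τ|)) - Real.exp (-(2 * π * (4 * |s * τ|))) := by
      unfold psM
      rw [h2]
      rw [show (8 * π * |s * τ|) = 2 * π * (4 * |s * τ|) by ring]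
      field_simp
    exact_mod_cast this
  linear_combination (-Complex.exp (2 * π * t * τ * I) * 𝓕 f τ) * this

end PSFourier

noncomputable section PSHalf

lemma ps_test_fourier {f : ℝ → ℂ} (hf : ContDiff ℝ (⊤:ℕ∞) f) (hc : HasCompactSupport f) :
    Continuous f ∧ Integrable f ∧ Integrable (𝓕 f) ∧ Integrable (fun τ : ℝ => (√|τ| : ℂ) * 𝓕 f τ) := by
  have e : (hc.toSchwartzMap hf : ℝ → ℂ) = f := rfl
  set g := hc.toSchwartzMap hf
  have e2 : ((𝓕 g : SchwartzMap ℝ ℂ) : ℝ → ℂ) = 𝓕 f := by rw [SchwartzMap.fourier_coe, e]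
  have h0 : Integrable (𝓕 f) := by rw [← e2]; exact SchwartzMap.integrable _
  have h1 : Integrable (fun τ : ℝ => ‖τ‖ ^ 1 * ‖𝓕 f τ‖) := by
    rw [← e2]; exact SchwartzMap.integrable_pow_mul volume _ 1
  refine ⟨hf.continuous, hf.continuous.integrable_of_hasCompactSupport hc, h0, ?_⟩
  refine (h1.add h0.norm).mono' ?_ (Eventually.of_forall fun τ => ?_)
  · exact (by fun_prop : Continuous fun τ : ℝ => (√|τ| : ℂ)).aestronglyMeasurable.mul h0.1
  · rw [norm_mul, Complex.norm_real, Real.norm_of_nonneg (Real.sqrt_nonneg _)]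
    have : √|τ| ≤ |τ| + 1 := by
      rw [Real.sqrt_le_left (by positivity)]
      nlinarith [abs_nonneg τ]
    simp only [Pi.add_apply, pow_one, Real.norm_eq_abs]
    nlinarith [norm_nonneg (𝓕 f τ)]

def psU (u : ℝ) : ℝ := u ^ (-(3/2) : ℝ)

lemma ps_U_int_one : IntegrableOn psU (Ioi 1) := by
  unfold psU
  exact integrableOn_Ioi_rpow_of_lt (by norm_num) one_pos

lemma ps_U_int_zero : IntegrableOn (fun u => u * psU u) (Ioc 0 1) := by
  have h : IntegrableOn (fun u : ℝ => u ^ (-(1/2) : ℝ)) (Ioc 0 1) := by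
    rw [← intervalIntegrable_iff_integrableOn_Ioc_of_le zero_le_one]
    exact intervalIntegral.intervalIntegrable_rpow' (by norm_num)
  refine h.congr_fun (fun u hu => ?_) measurableSet_Ioc
  have hu := hu.1
  simp only [psU]
  rw [mul_comm, ← Real.rpow_add_one hu.ne']
  norm_num

lemma ps_U_nonneg {u : ℝ} (hu : 0 < u) : 0 ≤ psU u := by unfold psU; positivity

lemma ps_U_meas : Measurable psU := by unfold psU; fun_prop

/-- dominating function -/
def psDom (u : ℝ) : ℝ := if u ≤ 1 then u * psU u else psU u

lemma ps_dom_int : IntegrableOn psDom (Ioi 0) := by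
  rw [← Ioc_union_Ioi_eq_Ioi zero_le_one, integrableOn_union]
  constructor
  · refine ps_U_int_zero.congr_fun (fun u hu => ?_) measurableSet_Ioc
    simp [psDom, hu.2]
  · refine ps_U_int_one.congr_fun (fun u hu => ?_) measurableSet_Ioi
    have : ¬ u ≤ 1 := not_le.2 hu
    simp [psDom, this]

lemma ps_dom_bound {x L M u : ℝ} (hL : x ≤ L * u) (hM : x ≤ M) (hLM : L ≤ M) (hu : 0 < u) :
    x * psU u ≤ M * psDom u := by
  have h := ps_U_nonneg hu
  unfold psDom
  split_ifs with h1
  · rw [← mul_assoc]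
    gcongr
    nlinarith
  · gcongr

lemma ps_one_sub_cos (x : ℝ) : 2 - 2 * Real.cos x ≤ 2 * |x| := by
  by_cases h : |x| ≤ 2
  · have := Real.one_sub_sq_div_two_le_cos (x := x)
    have h2 := sq_abs x
    nlinarith [abs_nonneg x]
  · have := Real.neg_one_le_cos x
    push Not at h
    linarith

lemma ps_cos_int (τ : ℝ) : IntegrableOn (fun u => (2 - 2 * Real.cos (2 * π * (u * τ))) * psU u) (Ioi 0) := by
  refine (ps_dom_int.const_mul (max (2 * (2 * π * |τ|)) 4)).mono' ?_ ?_
  · have := ps_U_meas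
    apply Measurable.aestronglyMeasurable
    fun_prop
  · filter_upwards [self_mem_ae_restrict measurableSet_Ioi] with u hu
    have hu : 0 < u := hu
    have h1 := ps_one_sub_cos (2 * π * (u * τ))
    have h2 := Real.neg_one_le_cos (2 * π * (u * τ))
    have h3 := Real.cos_le_one (2 * π * (u * τ))
    rw [Real.norm_of_nonneg (mul_nonneg (by linarith) (ps_U_nonneg hu))]
    refine ps_dom_bound (L := 2 * (2 * π * |τ|)) ?_ ?_ (le_max_left _ _) hu
    · rw [abs_mul, abs_mul, abs_mul, abs_of_pos hu, abs_of_pos Real.pi_pos] at h1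
      simp only [Nat.abs_ofNat] at h1
      linarith
    · exact le_trans (by linarith) (le_max_right _ _)

def psC0 : ℝ := ∫ u in Ioi (0:ℝ), (2 - 2 * Real.cos (2 * π * u)) * psU u

lemma ps_C0_scale (τ : ℝ) : ∫ u in Ioi (0:ℝ), (2 - 2 * Real.cos (2 * π * (u * τ))) * psU u = psC0 * √|τ| := by
  rcases eq_or_ne τ 0 with rfl | h
  · simp
  have hp : 0 < |τ| := abs_pos.2 h
  have h1 := integral_comp_mul_right_Ioi (fun u => (2 - 2 * Real.cos (2 * π * u)) * psU u) 0 hp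
  rw [zero_mul] at h1
  change _ = _ • psC0 at h1
  have h2 : ∫ u in Ioi (0:ℝ), (2 - 2 * Real.cos (2 * π * (u * τ))) * psU u =
      ∫ u in Ioi (0:ℝ), (|τ| * √|τ|) * ((2 - 2 * Real.cos (2 * π * (u * |τ|))) * psU (u * |τ|)) := by
    refine setIntegral_congr_fun measurableSet_Ioi fun u hu => ?_
    have hu : 0 < u := hu
    have hc : Real.cos (2 * π * (u * τ)) = Real.cos (2 * π * (u * |τ|)) := by
      rcases abs_choice τ with h | h <;> rw [h]
      rw [← Real.cos_neg]; congr 1; ring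
    have hU : psU u = (|τ| * √|τ|) * psU (u * |τ|) := by
      unfold psU
      rw [Real.mul_rpow hu.le hp.le, Real.sqrt_eq_rpow]
      have : |τ| * |τ| ^ (1/2:ℝ) = |τ| ^ (3/2:ℝ) := by
        rw [← Real.rpow_one_add' hp.le (by norm_num)]; norm_num
      rw [this, mul_left_comm, ← Real.rpow_add hp]
      norm_num
    simp only [hc]
    rw [hU]; ring
  rw [h2, integral_const_mul, h1, smul_eq_mul]
  field_simp

lemma ps_C0_pos : 0 < psC0 := by
  have h1 := ps_cos_int 1
  simp only [mul_one] at h1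
  unfold psC0
  rw [setIntegral_pos_iff_support_of_nonneg_ae _ h1]
  · have : Ioo (0:ℝ) 1 ⊆ (Function.support fun u => (2 - 2 * Real.cos (2 * π * u)) * psU u) ∩ Ioi 0 := by
      intro u hu
      refine ⟨?_, hu.1⟩
      have h2 : Real.cos (2 * π * u) ≠ 1 := by
        intro h
        rw [Real.cos_eq_one_iff] at h
        obtain ⟨k, hk⟩ := h
        have : (k:ℝ) = u := by
          have := Real.pi_pos
          field_simp at hk
          linarith
        have a1 := hu.1
        have a2 := hu.2
        rw [← this] at a1 a2
        have b1 : 0 < k := by exact_mod_cast a1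
        have b2 : k < 1 := by exact_mod_cast a2
        omega
      have h3 : psU u ≠ 0 := by
        unfold psU
        exact (Real.rpow_pos_of_pos hu.1 _).ne'
      simp only [Function.mem_support]
      refine mul_ne_zero ?_ h3
      intro h; apply h2; linarith
    refine lt_of_lt_of_le ?_ (measure_mono this)
    simp
  · filter_upwards [self_mem_ae_restrict measurableSet_Ioi] with u hu
    have h3 := Real.cos_le_one (2 * π * u)
    exact mul_nonneg (by linarith) (ps_U_nonneg hu)

lemma ps_half_formula {f : ℝ → ℂ} (hf : Continuous f) (hfi : Integrable f) (hF : Integrable (𝓕 f))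
    (hH : Integrable (fun τ : ℝ => (√|τ| : ℂ) * 𝓕 f τ)) (t : ℝ) :
    ∫ u in Ioi (0:ℝ), (2 * f t - f (t + u) - f (t - u)) * psU u =
      psC0 * 𝓕⁻ (fun τ : ℝ => (√|τ| : ℂ) * 𝓕 f τ) t := by
  have hinv : 𝓕⁻ (𝓕 f) = f := (hf.fourierInv_fourier_eq hfi hF)
  have hval : ∀ t, f t = ∫ τ : ℝ, Complex.exp (2 * π * t * τ * I) * 𝓕 f τ := by
    intro t
    conv_lhs => rw [← hinv]
    rw [ps_fourierInv]
  have hintg : ∀ t : ℝ, Integrable (fun τ : ℝ => Complex.exp (2 * π * t * τ * I) * 𝓕 f τ) := by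
    intro t
    refine hF.bdd_mul (c := 1) (by
      apply Continuous.aestronglyMeasurable; fun_prop) (Eventually.of_forall fun x => ?_)
    rw [show (2 * π * t * x * I : ℂ) = 2 * π * (t * x : ℝ) * I by push_cast; ring, ps_norm_exp]
  have h1 : ∀ u : ℝ, (2 * f t - f (t + u) - f (t - u)) * psU u =
      ∫ τ : ℝ, Complex.exp (2 * π * t * τ * I) * 𝓕 f τ * (((2 - 2 * Real.cos (2 * π * (u * τ))) * psU u : ℝ) : ℂ) := by
    intro u
    have hi : Integrable (fun τ : ℝ => 2 * (Complex.exp (2 * π * t * τ * I) * 𝓕 f τ) -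
        Complex.exp (2 * π * (t + u : ℝ) * τ * I) * 𝓕 f τ) := ((hintg t).const_mul 2).sub (hintg (t + u))
    rw [hval t, hval (t+u), hval (t-u), ← integral_const_mul, ← integral_sub ((hintg t).const_mul 2) (hintg _),
      ← integral_sub hi (hintg _), ← integral_mul_const]
    congr 1
    ext τ
    have e1 : Complex.exp (2 * π * (t + u : ℝ) * τ * I) = Complex.exp (2 * π * t * τ * I) * Complex.exp (2 * π * (u * τ) * I) := by
      rw [← Complex.exp_add]; congr 1; push_cast; ring
    have e2 : Complex.exp (2 * π * (t - u : ℝ) * τ * I) = Complex.exp (2 * π * t * τ * I) * Complex.exp (-(2 * π * (u * τ)) * I) := by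
      rw [← Complex.exp_add]; congr 1; push_cast; ring
    rw [e1, e2]
    push_cast
    rw [Complex.cos]
    ring
  simp_rw [h1]
  rw [integral_integral_swap]
  · rw [ps_fourierInv, ← integral_const_mul]
    congr 1
    ext τ
    have h5 : ∫ u in Ioi (0:ℝ), (((2 - 2 * Real.cos (2 * π * (u * τ))) * psU u : ℝ) : ℂ) =
        ((∫ u in Ioi (0:ℝ), ((2 - 2 * Real.cos (2 * π * (u * τ))) * psU u) : ℝ) : ℂ) := integral_ofReal
    rw [integral_const_mul, h5, ps_C0_scale]
    push_cast
    ring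
  · have hmeas : AEStronglyMeasurable (Function.uncurry fun (u τ : ℝ) => Complex.exp (2 * π * t * τ * I) * 𝓕 f τ * (((2 - 2 * Real.cos (2 * π * (u * τ))) * psU u : ℝ) : ℂ))
        ((volume.restrict (Ioi 0)).prod volume) := by
      have hc : Measurable (𝓕 f) := by
        have : (fun t => 𝓕⁻ f (-t)) = 𝓕 f := by
          ext w
          rw [ps_fourierInv, ps_fourier]
          congr 1
          ext v
          congr 2
          push_cast; ring
        rw [← this]
        exact ((ps_fourierInv_continuous hfi).comp continuous_neg).measurable
      have := ps_U_meas
      apply Measurable.aestronglyMeasurable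
      unfold Function.uncurry
      fun_prop
    rw [integrable_prod_iff' hmeas]
    constructor
    · refine Eventually.of_forall fun τ => ?_
      have h6 : Integrable (fun u : ℝ => (((2 - 2 * Real.cos (2 * π * (u * τ))) * psU u : ℝ) : ℂ))
        (volume.restrict (Ioi 0)) := (ps_cos_int τ).ofReal
      exact h6.const_mul (Complex.exp (2 * π * t * τ * I) * 𝓕 f τ)
    · have : ∀ τ : ℝ, ∫ u in Ioi (0:ℝ), ‖Function.uncurry (fun (u τ : ℝ) => Complex.exp (2 * π * t * τ * I) * 𝓕 f τ * (((2 - 2 * Real.cos (2 * π * (u * τ))) * psU u : ℝ) : ℂ)) (u, τ)‖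
          = psC0 * ‖(√|τ| : ℂ) * 𝓕 f τ‖ := by
        intro τ
        have h3 : ∫ u in Ioi (0:ℝ), ‖𝓕 f τ‖ * ((2 - 2 * Real.cos (2 * π * (u * τ))) * psU u) = psC0 * ‖(√|τ| : ℂ) * 𝓕 f τ‖ := by
          rw [integral_const_mul, ps_C0_scale, norm_mul, Complex.norm_real, Real.norm_of_nonneg (Real.sqrt_nonneg _)]
          ring
        rw [← h3]
        refine setIntegral_congr_fun measurableSet_Ioi fun u hu => ?_
        simp only [Function.uncurry]
        have h4 := Real.cos_le_one (2 * π * (u * τ))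
        rw [norm_mul, norm_mul, Complex.norm_real, Real.norm_of_nonneg (mul_nonneg (by linarith) (ps_U_nonneg hu)),
          show (2 * π * t * τ * I : ℂ) = 2 * π * (t * τ : ℝ) * I by push_cast; ring, ps_norm_exp, one_mul]
      simp_rw [this]
      exact hH.norm.const_mul _

end PSHalf

noncomputable section PSDecay

lemma ps_half_decay (R M L : ℝ) (hR : 1 ≤ R) (hM : 0 ≤ M) (hL : 0 ≤ L) : ∃ K : ℝ, 0 ≤ K ∧ ∀ f : ℝ → ℂ,
    ContDiff ℝ (⊤:ℕ∞) f → HasCompactSupport f → (∀ t, ‖f t‖ ≤ M) → (∀ t, R < |t| → f t = 0) →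
    (∀ s t, ‖f s - f t‖ ≤ L * |s - t|) → ∀ t, ‖𝓕⁻ (fun τ : ℝ => (√|τ| : ℂ) * 𝓕 f τ) t‖ ≤ K * psW t := by
  set X := max (2 * L) (4 * M)
  set I0 := ∫ u in Ioi (0:ℝ), X * psDom u
  have hX : 0 ≤ X := le_max_of_le_left (by positivity)
  have hdom0 : ∀ u, 0 < u → 0 ≤ psDom u := fun u hu => by
    have := ps_U_nonneg hu
    unfold psDom; split_ifs <;> positivity
  have hI0 : 0 ≤ I0 := setIntegral_nonneg measurableSet_Ioi fun u hu => mul_nonneg hX (hdom0 u hu)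
  have hc := ps_C0_pos
  set K1 := psC0⁻¹ * I0 * (1 + 2 * R) ^ ((3/2):ℝ)
  set K2 := psC0⁻¹ * (2 * M * 8 * (2 * R))
  have hK1 : 0 ≤ K1 := by positivity
  have hK2 : 0 ≤ K2 := by positivity
  refine ⟨K1 + K2, by positivity, fun f hf hfc hfM hfR hfL t => ?_⟩
  obtain ⟨a1, a2, a3, a4⟩ := ps_test_fourier hf hfc
  have hform := ps_half_formula a1 a2 a3 a4 t
  have hW := ps_W_pos t
  have e1 : ‖𝓕⁻ (fun τ : ℝ => (√|τ| : ℂ) * 𝓕 f τ) t‖ = psC0⁻¹ * ‖∫ u in Ioi (0:ℝ), (2 * f t - f (t + u) - f (t - u)) * psU u‖ := by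
    rw [hform, norm_mul, Complex.norm_real, Real.norm_of_nonneg hc.le]
    field_simp
  rw [e1]
  by_cases ht : |t| < 2 * R
  · have b1 : ‖∫ u in Ioi (0:ℝ), (2 * f t - f (t + u) - f (t - u)) * psU u‖ ≤ I0 := by
      refine norm_integral_le_of_norm_le (ps_dom_int.const_mul X) ?_
      filter_upwards [self_mem_ae_restrict measurableSet_Ioi] with u hu
      have hu : 0 < u := hu
      rw [norm_mul, Complex.norm_real, Real.norm_of_nonneg (ps_U_nonneg hu)]
      refine ps_dom_bound (L := 2 * L) ?_ ?_ (le_max_left _ _) hu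
      · have h1 := hfL t (t+u)
        have h2 := hfL t (t-u)
        have e3 : |t - (t+u)| = u := by rw [show t - (t+u) = -u by ring, abs_neg, abs_of_pos hu]
        have e4 : |t - (t-u)| = u := by rw [show t - (t-u) = u by ring, abs_of_pos hu]
        rw [e3] at h1; rw [e4] at h2
        have : 2 * f t - f (t + u) - f (t - u) = (f t - f (t+u)) + (f t - f (t-u)) := by ring
        rw [this]
        refine (norm_add_le _ _).trans (by linarith)
      · refine le_trans ?_ (le_max_right _ _)
        refine (norm_sub_le _ _).trans ?_
        have h1 := norm_sub_le (2 * f t) (f (t+u))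
        rw [norm_mul] at h1
        have := hfM t
        have := hfM (t+u)
        have := hfM (t-u)
        simp only [Complex.norm_ofNat] at h1
        linarith
    have b2 : 1 ≤ (1 + 2 * R) ^ ((3/2):ℝ) * psW t := by
      unfold psW
      rw [Real.rpow_neg (by positivity), ← div_eq_mul_inv, one_le_div (by positivity)]
      gcongr
    calc psC0⁻¹ * _ ≤ psC0⁻¹ * I0 * 1 := by rw [mul_one]; gcongr
      _ ≤ psC0⁻¹ * I0 * ((1 + 2 * R) ^ ((3/2):ℝ) * psW t) := by gcongr
      _ = K1 * psW t := by ring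
      _ ≤ _ := by gcongr; linarith
  · push Not at ht
    have b0 : psU (|t|/2) ≤ 8 * psW t := by
      unfold psU psW
      have h4 : (8:ℝ) = 4 ^ ((3/2):ℝ) := by
        rw [show (4:ℝ) = 2 ^ (2:ℝ) by norm_num, ← Real.rpow_mul (by norm_num)]; norm_num
      have : 0 < |t| := by linarith
      rw [h4, Real.rpow_neg (by positivity), Real.rpow_neg (by positivity), ← div_eq_mul_inv,
        ← Real.div_rpow (by positivity) (by positivity), ← Real.inv_rpow (by positivity)]
      refine Real.rpow_le_rpow (by positivity) ?_ (by norm_num)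
      rw [inv_div, div_le_div_iff₀ (by positivity) (by positivity)]
      linarith
    have ht0 : f t = 0 := hfR t (by linarith)
    have b1 : ‖∫ u in Ioi (0:ℝ), (2 * f t - f (t + u) - f (t - u)) * psU u‖ ≤
        ∫ u in Ioi (0:ℝ), (Icc (|t| - R) (|t| + R)).indicator (fun _ => 2 * M * psU (|t|/2)) u := by
      refine norm_integral_le_of_norm_le ?_ ?_
      · apply Integrable.integrableOn
        rw [integrable_indicator_iff measurableSet_Icc]
        exact integrableOn_const (by simp) enorm_ne_top
      · filter_upwards [self_mem_ae_restrict measurableSet_Ioi] with u hu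
        have hu : 0 < u := hu
        by_cases h : u ∈ Icc (|t| - R) (|t| + R)
        · rw [indicator_of_mem h, norm_mul, Complex.norm_real, Real.norm_of_nonneg (ps_U_nonneg hu), ht0]
          have h2 : psU u ≤ psU (|t|/2) := by
            unfold psU
            refine Real.rpow_le_rpow_of_nonpos (by linarith) ?_ (by norm_num)
            linarith [h.1]
          gcongr
          · exact ps_U_nonneg hu
          · refine (norm_sub_le _ _).trans ?_
            have := hfM (t+u)
            have := hfM (t-u)
            rw [mul_zero, zero_sub, norm_neg]
            linarith
        · rw [indicator_of_notMem h, ht0]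
          have h2 : R < |t + u| ∧ R < |t - u| := by
            have : R < abs (|t| - u) := by
              by_contra hcon
              push Not at hcon
              rw [abs_le] at hcon
              exact h ⟨by linarith, by linarith⟩
            have h3 := abs_abs_sub_abs_le_abs_sub t u
            have h4 := abs_abs_sub_abs_le_abs_sub t (-u)
            rw [abs_neg] at h4
            rw [abs_of_pos hu] at h3 h4
            constructor
            · rw [← sub_neg_eq_add]; linarith
            · linarith
          rw [hfR _ h2.1, hfR _ h2.2]
          simp
    have b3 : ∫ u in Ioi (0:ℝ), (Icc (|t| - R) (|t| + R)).indicator (fun _ => 2 * M * psU (|t|/2)) u = 2 * M * psU (|t|/2) * (2 * R) := by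
      rw [setIntegral_indicator measurableSet_Icc]
      have : Ioi 0 ∩ Icc (|t| - R) (|t| + R) = Icc (|t| - R) (|t| + R) := by
        apply inter_eq_right.2
        intro u hu
        have := hu.1
        simp only [mem_Ioi]; linarith
      rw [this, setIntegral_const]
      simp [Measure.real]
      rw [ENNReal.toReal_ofReal (by linarith)]
      ring
    rw [b3] at b1
    calc psC0⁻¹ * _ ≤ psC0⁻¹ * (2 * M * psU (|t|/2) * (2 * R)) := by gcongr
      _ ≤ psC0⁻¹ * (2 * M * (8 * psW t) * (2 * R)) := by gcongr
      _ = K2 * psW t := by ring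
      _ ≤ _ := by gcongr; linarith

lemma ps_slice {n : ℕ} {φ : Pt n → ℂ} (h : ContDiff ℝ (⊤:ℕ∞) φ) (hc : HasCompactSupport φ) (x : Spc n) :
    ContDiff ℝ (⊤:ℕ∞) (fun s : ℝ => φ (s, x)) ∧ HasCompactSupport (fun s : ℝ => φ (s, x)) := by
  constructor
  · fun_prop
  · refine HasCompactSupport.of_support_subset_isCompact (K := Set.image Prod.fst (tsupport φ)) (hc.isCompact.image continuous_fst) ?_
    intro s hs
    exact ⟨(s, x), subset_tsupport _ hs, rfl⟩

lemma ps_half_meas {n : ℕ} {φ : Pt n → ℂ} (h : ContDiff ℝ (⊤:ℕ∞) φ) (hc : HasCompactSupport φ) :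
    Measurable (halfDerivFun φ) := by
  have : halfDerivFun φ = fun z => (psC0 : ℂ)⁻¹ * ∫ u in Ioi (0:ℝ), (2 * φ (z.1, z.2) - φ (z.1 + u, z.2) - φ (z.1 - u, z.2)) * psU u := by
    ext z
    obtain ⟨h1, h2⟩ := ps_slice h hc z.2
    obtain ⟨a1, a2, a3, a4⟩ := ps_test_fourier h1 h2
    have hform := ps_half_formula a1 a2 a3 a4 z.1
    have h0 : (psC0 : ℂ) ≠ 0 := by exact_mod_cast ps_C0_pos.ne'
    rw [hform]
    unfold halfDerivFun
    rw [inv_mul_cancel_left₀ h0]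
  rw [this]
  refine Measurable.const_mul ?_ _
  apply StronglyMeasurable.measurable
  have hm : StronglyMeasurable (fun w : Pt n × ℝ => (2 * φ (w.1.1, w.1.2) - φ (w.1.1 + w.2, w.1.2) - φ (w.1.1 - w.2, w.1.2)) * (psU w.2 : ℂ)) := by
    apply Measurable.stronglyMeasurable
    have := ps_U_meas
    have := h.continuous.measurable
    fun_prop
  exact hm.integral_prod_right' (ν := volume.restrict (Ioi 0))

lemma ps_radius {n : ℕ} {φ : Pt n → ℂ} (hc : HasCompactSupport φ) :
    ∃ R : ℝ, 1 ≤ R ∧ ∀ t x, R < |t| ∨ R < ‖x‖ → φ (t, x) = 0 := by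
  obtain ⟨R, hR⟩ := hc.isCompact.isBounded.subset_closedBall (0 : Pt n)
  refine ⟨max R 1, le_max_right _ _, fun t x htx => ?_⟩
  by_contra hne
  have h1 := hR (subset_tsupport _ (show (t,x) ∈ Function.support φ from hne))
  rw [mem_closedBall_zero_iff, Prod.norm_def, max_le_iff, Real.norm_eq_abs] at h1
  have := le_max_left R 1
  rcases htx with h | h
  · linarith [h1.1]
  · have := h1.2; simp only at this; linarith

lemma ps_half_bound {n : ℕ} {φ : Pt n → ℂ} (h : ContDiff ℝ (⊤:ℕ∞) φ) (hc : HasCompactSupport φ) :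
    ∃ K R : ℝ, 0 ≤ K ∧ ∀ t x, ‖halfDerivFun φ (t, x)‖ ≤ K * psW t * (closedBall (0 : Spc n) R).indicator 1 x := by
  obtain ⟨R, hR1, hR⟩ := ps_radius hc
  obtain ⟨M, hM⟩ := h.continuous.bounded_above_of_compact_support hc
  have hM0 : 0 ≤ M := (norm_nonneg _).trans (hM 0)
  obtain ⟨L, hL⟩ := h.lipschitzWith_of_hasCompactSupport hc (by simp)
  obtain ⟨K, hK, hb⟩ := ps_half_decay R M L hR1 hM0 L.2
  refine ⟨K, R, hK, fun t x => ?_⟩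
  by_cases hx : x ∈ closedBall (0 : Spc n) R
  · rw [indicator_of_mem hx, Pi.one_apply, mul_one]
    obtain ⟨h1, h2⟩ := ps_slice h hc x
    refine hb _ h1 h2 (fun t => hM _) (fun t ht => hR t x (Or.inl ht)) ?_ t
    intro s t
    have := hL.dist_le_mul (s,x) (t,x)
    rw [dist_eq_norm] at this
    simpa [Prod.dist_eq, Real.dist_eq] using this
  · rw [indicator_of_notMem hx]
    have : (fun s => φ (s, x)) = 0 := by
      ext s
      apply hR
      right
      rw [mem_closedBall_zero_iff] at hx
      linarith
    simp only [halfDerivFun, this]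
    have h0 : 𝓕 (0 : ℝ → ℂ) = 0 := by ext; simp [ps_fourier]
    rw [h0]
    simp [ps_fourierInv]

lemma ps_half_integrable {n : ℕ} {φ : Pt n → ℂ} (h : ContDiff ℝ (⊤:ℕ∞) φ) (hc : HasCompactSupport φ) {p : ℝ} (hp : 1 < p) :
    Integrable (fun z => ‖halfDerivFun φ z‖ ^ p) := by
  obtain ⟨K, R, hK, hb⟩ := ps_half_bound h hc
  have hi : Integrable ((closedBall (0 : Spc n) R).indicator (1 : Spc n → ℝ)) := by
    rw [integrable_indicator_iff measurableSet_closedBall]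
    exact integrableOn_const (C := (1:ℝ)) (isCompact_closedBall _ _).measure_lt_top.ne (by simp)
  have hi2 : Integrable (fun z : Pt n => (K ^ p * psW z.1) * (closedBall (0 : Spc n) R).indicator (1 : Spc n → ℝ) z.2) :=
    (ps_W_integrable.const_mul (K^p)).mul_prod hi
  refine hi2.mono' ?_ (Eventually.of_forall fun z => ?_)
  · have := ps_half_meas h hc
    apply Measurable.aestronglyMeasurable
    fun_prop
  · have h1 := hb z.1 z.2
    have hw := ps_W_pos z.1
    rw [Real.norm_of_nonneg (by positivity)]
    refine (Real.rpow_le_rpow (norm_nonneg _) h1 (by linarith)).trans ?_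
    have hw1 : psW z.1 ^ p ≤ psW z.1 := by
      conv_rhs => rw [← Real.rpow_one (psW z.1)]
      exact Real.rpow_le_rpow_of_exponent_ge hw (ps_W_le_one _) hp.le
    by_cases hx : z.2 ∈ closedBall (0 : Spc n) R
    · rw [indicator_of_mem hx]
      simp only [Pi.one_apply, mul_one]
      rw [Real.mul_rpow hK hw.le]
      gcongr
    · rw [indicator_of_notMem hx]
      simp only [mul_zero]
      rw [Real.zero_rpow (by linarith)]

end PSDecay

noncomputable section PSHed

lemma ps_hed_eps {a C M A D : ℝ} (hM : 0 < M) (hA : 0 < A) (hC : 0 ≤ C) (hD : 1 < D)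
    (h : ∀ k : ℤ, a ≤ C * ((2:ℝ)^k * M + ((2:ℝ)^k) ^ (1 - D) * A)) :
    a ≤ C * (1 + 2 ^ (D - 1)) * (M ^ (1 - D⁻¹) * A ^ D⁻¹) := by
  have hl : 0 < (A / M) ^ D⁻¹ := by positivity
  set l := (A / M) ^ D⁻¹ with hldef
  obtain ⟨k, hk1, hk2⟩ := exists_mem_Ico_zpow hl (by norm_num : (1:ℝ) < 2)
  have h2k : (0:ℝ) < 2 ^ k := by positivity
  have hlM : l * M = M ^ (1 - D⁻¹) * A ^ D⁻¹ := by
    rw [hldef, Real.div_rpow hA.le hM.le, Real.rpow_sub hM, Real.rpow_one]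
    field_simp
  have hlD : l ^ (1 - D) * A = l * M := by
    rw [Real.rpow_sub hl, Real.rpow_one, hldef, ← Real.rpow_mul (by positivity), inv_mul_cancel₀ (by linarith), Real.rpow_one]
    field_simp
  have h3 : ((2:ℝ)^k) ^ (1 - D) ≤ 2 ^ (D - 1) * l ^ (1 - D) := by
    have : l / 2 ≤ 2 ^ k := by
      rw [zpow_add_one₀ (by norm_num)] at hk2; linarith
    refine (Real.rpow_le_rpow_of_nonpos (by positivity) this (by linarith)).trans ?_
    rw [Real.div_rpow hl.le (by norm_num), show D - 1 = -(1 - D) by ring, Real.rpow_neg (by norm_num)]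
    rw [div_eq_inv_mul]
  refine (h k).trans ?_
  rw [← hlM, mul_assoc]
  refine mul_le_mul_of_nonneg_left ?_ hC
  calc (2:ℝ)^k * M + ((2:ℝ)^k) ^ (1 - D) * A ≤ l * M + (2 ^ (D - 1) * l ^ (1 - D)) * A := by gcongr
    _ = l * M + 2 ^ (D-1) * (l ^ (1 - D) * A) := by ring
    _ = _ := by rw [hlD]; ring

lemma ps_hed {a C M A D : ℝ} (hM : 0 ≤ M) (hA : 0 ≤ A) (hC : 0 ≤ C) (hD : 1 < D)
    (h : ∀ k : ℤ, a ≤ C * ((2:ℝ)^k * M + ((2:ℝ)^k) ^ (1 - D) * A)) :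
    a ≤ C * (1 + 2 ^ (D - 1)) * (M ^ (1 - D⁻¹) * A ^ D⁻¹) := by
  have h1 : ∀ e : ℝ, 0 < e → a ≤ C * (1 + 2 ^ (D - 1)) * ((M + e) ^ (1 - D⁻¹) * (A + e) ^ D⁻¹) := by
    intro e he
    refine ps_hed_eps (by positivity) (by positivity) hC hD fun k => (h k).trans ?_
    gcongr <;> linarith
  have hDi : D⁻¹ < 1 := inv_lt_one_of_one_lt₀ hD
  have hc : Continuous fun e : ℝ => C * (1 + 2 ^ (D - 1)) * ((M + e) ^ (1 - D⁻¹) * (A + e) ^ D⁻¹) := by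
    have h2 : Continuous fun e : ℝ => (M + e) ^ (1 - D⁻¹) := (continuous_const.add continuous_id).rpow_const fun _ => Or.inr (by linarith)
    have h3 : Continuous fun e : ℝ => (A + e) ^ D⁻¹ := (continuous_const.add continuous_id).rpow_const fun _ => Or.inr (by positivity)
    exact continuous_const.mul (h2.mul h3)
  have ht := (hc.tendsto 0).mono_left (nhdsWithin_le_nhds (s := Ioi 0))
  simp only [add_zero] at ht
  refine ge_of_tendsto ht ?_
  filter_upwards [self_mem_nhdsWithin] with e he using h1 e he

lemma ps_tele {P : ℤ → ℂ} {a : ℂ} {M A ρ : ℝ} (h0 : Tendsto (fun k : ℕ => P (-(k:ℤ))) atTop (𝓝 a))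
    (hi : Tendsto (fun k : ℕ => P k) atTop (𝓝 0)) (hρ : 0 < ρ) (hρ1 : ρ < 1)
    (h1 : ∀ k, ‖P k - P (k+1)‖ ≤ 2 ^ k * M) (h2 : ∀ k, ‖P k - P (k+1)‖ ≤ ρ ^ k * A) (m : ℤ) :
    ‖a‖ ≤ 2 ^ m * M + ρ ^ m * A / (1 - ρ) := by
  have t1 : Tendsto (fun k : ℕ => P (m - k)) atTop (𝓝 a) := by
    have hh : Tendsto (fun k : ℕ => ((k : ℤ) - m).toNat) atTop atTop := by
      refine tendsto_atTop.2 fun b => ?_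
      filter_upwards [eventually_ge_atTop (b + m.natAbs)] with k hk
      omega
    refine (h0.comp hh).congr' ?_
    filter_upwards [eventually_ge_atTop m.natAbs] with k hk
    simp only [Function.comp]
    congr 1
    omega
  have t2 : Tendsto (fun k : ℕ => P (m + k)) atTop (𝓝 0) := by
    have hh : Tendsto (fun k : ℕ => (m + (k : ℤ)).toNat) atTop atTop := by
      refine tendsto_atTop.2 fun b => ?_
      filter_upwards [eventually_ge_atTop (b + m.natAbs)] with k hk
      omega
    refine (hi.comp hh).congr' ?_
    filter_upwards [eventually_ge_atTop m.natAbs] with k hk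
    simp only [Function.comp]
    congr 1
    omega
  have e1 := dist_le_of_le_geometric_of_tendsto₀ (1/2 : ℝ) (2 ^ m * M / 2) (by norm_num) (f := fun k : ℕ => P (m - k)) (fun k => by
    have := h1 (m - (k+1))
    rw [show m - ((k:ℤ)+1) + 1 = m - k by ring] at this
    rw [dist_comm, dist_eq_norm]
    push_cast
    refine this.trans (le_of_eq ?_)
    rw [zpow_sub₀ (by norm_num), zpow_add₀ (by norm_num)]
    simp only [zpow_natCast, zpow_one, one_div, inv_pow]
    field_simp) t1
  have e2 := dist_le_of_le_geometric_of_tendsto₀ ρ (ρ ^ m * A) hρ1 (f := fun k : ℕ => P (m + k)) (fun k => by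
    have := h2 (m + k)
    rw [dist_eq_norm]
    push_cast
    rw [← add_assoc]
    refine this.trans (le_of_eq ?_)
    rw [zpow_add₀ hρ.ne', zpow_natCast]
    ring) t2
  simp only [Nat.cast_zero, sub_zero, add_zero, dist_zero_right] at e1 e2
  rw [dist_comm, dist_eq_norm] at e1
  have := norm_add_le (a - P m) (P m)
  rw [sub_add_cancel] at this
  have e3 : (2:ℝ) ^ m * M / 2 / (1 - 1 / 2) = 2 ^ m * M := by ring
  linarith

end PSHed

noncomputable section PSSr

lemma ps_W_dyadic (v : ℝ) : ENNReal.ofReal (psW v) ≤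
    ∑' j : ℕ, ENNReal.ofReal (4 * ((2:ℝ)^j) ^ (-(3/2):ℝ)) * (closedBall (0:ℝ) (2^j)).indicator 1 v := by
  have hex : ∃ j : ℕ, |v| ≤ 2 ^ j := by
    obtain ⟨j, hj⟩ := pow_unbounded_of_one_lt |v| (by norm_num : (1:ℝ) < 2)
    exact ⟨j, hj.le⟩
  classical
  set j := Nat.find hex with hj
  have h1 : |v| ≤ 2 ^ j := Nat.find_spec hex
  refine le_trans ?_ (ENNReal.le_tsum j)
  rw [indicator_of_mem (by simpa using h1), Pi.one_apply, mul_one]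
  apply ENNReal.ofReal_le_ofReal
  unfold psW
  have h4 : (2:ℝ) ^ ((3/2):ℝ) ≤ 4 := by
    rw [show (4:ℝ) = 2 ^ (2:ℝ) by norm_num]
    exact Real.rpow_le_rpow_of_exponent_le (by norm_num) (by norm_num)
  have h5 : (2:ℝ)^j / 2 ≤ 1 + |v| := by
    rcases Nat.eq_zero_or_pos j with h0 | h0
    · rw [h0]; simp; linarith [abs_nonneg v]
    · have := Nat.find_min hex (m := j - 1) (by omega)
      push Not at this
      have e : (2:ℝ)^j = 2^(j-1) * 2 := by rw [← pow_succ]; congr 1; omega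
      rw [e]; linarith
  refine (Real.rpow_le_rpow_of_nonpos (by positivity) h5 (by norm_num)).trans ?_
  rw [Real.div_rpow (by positivity) (by norm_num), Real.rpow_neg (by norm_num : (0:ℝ) ≤ 2), div_inv_eq_mul, mul_comm]
  gcongr

lemma ps_W_max : ∃ C : ℝ≥0∞, C ≠ ∞ ∧ ∀ h : ℝ → ℝ≥0∞, Measurable h → ∀ (t : ℝ) (k : ℤ),
    ∫⁻ v, ENNReal.ofReal (psW v) * h (t - 2 ^ k * v) ≤ C * psMax h t := by
  refine ⟨∑' j : ℕ, 4 * ENNReal.ofReal ((2:ℝ)^(-(1/2):ℝ)) ^ j, ?_, fun h hh t k => ?_⟩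
  · rw [ENNReal.tsum_mul_left, ENNReal.tsum_geometric]
    refine ENNReal.mul_ne_top (by simp) ?_
    rw [ENNReal.inv_ne_top]
    refine (tsub_pos_of_lt ?_).ne'
    rw [ENNReal.ofReal_lt_one]
    exact Real.rpow_lt_one_of_one_lt_of_neg (by norm_num) (by norm_num)
  have hb : ∀ j : ℕ, ∫⁻ v, (closedBall (0:ℝ) (2^j)).indicator 1 v * h (t - 2 ^ k * v) ≤ ENNReal.ofReal (2^j) * psMax h t := by
    intro j
    have e1 := ps_lintegral_affine (E := ℝ) (fun v => (closedBall (0:ℝ) (2^j)).indicator 1 v * h (t - 2 ^ k * v))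
      ((measurable_const.indicator measurableSet_closedBall).mul (hh.comp (by fun_prop))) 0 (r := 2^j) (by positivity)
    have e2 : ∫⁻ y : ℝ, (closedBall (0:ℝ) (2^j)).indicator 1 (0 + (2:ℝ)^j • y) * h (t - 2 ^ k * (0 + (2:ℝ)^j • y)) = psAvg ((2:ℝ)^(k + j)) h t := by
      unfold psAvg
      rw [← lintegral_indicator measurableSet_closedBall, ← lintegral_neg_eq_self]
      congr 1
      ext y
      by_cases hy : y ∈ closedBall (0:ℝ) 1
      · rw [indicator_of_mem hy]
        rw [indicator_of_mem]
        · simp only [Pi.one_apply, one_mul]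
          congr 1
          rw [zpow_add₀ (by norm_num), zpow_natCast]
          simp only [smul_eq_mul]
          ring
        · simp only [mem_closedBall_zero_iff, Real.norm_eq_abs, zero_add, smul_eq_mul, mul_neg, abs_neg, abs_mul] at hy ⊢
          rw [abs_of_pos (by positivity)]
          exact mul_le_of_le_one_right (by positivity) hy
      · rw [indicator_of_notMem hy]
        rw [indicator_of_notMem]
        · simp
        · simp only [mem_closedBall_zero_iff, Real.norm_eq_abs, zero_add, smul_eq_mul, mul_neg, abs_neg, abs_mul, not_le] at hy ⊢
          rw [abs_of_pos (by positivity : (0:ℝ) < 2^j)]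
          exact lt_mul_of_one_lt_right (by positivity) hy
    have e3 : psAvg ((2:ℝ)^(k + j)) h t ≤ psMax h t := le_iSup (fun k : ℤ => psAvg ((2:ℝ)^k) h t) (k + j)
    rw [e2] at e1
    rw [e1] at e3
    simp only [Module.finrank_self, pow_one] at e3
    have hp : (0:ℝ) < 2 ^ j := by positivity
    rw [ENNReal.ofReal_inv_of_pos hp, ENNReal.inv_mul_le_iff (by simp) (by simp)] at e3
    exact e3
  calc ∫⁻ v, ENNReal.ofReal (psW v) * h (t - 2 ^ k * v) 
      ≤ ∫⁻ v, ∑' j : ℕ, ENNReal.ofReal (4 * ((2:ℝ)^j) ^ (-(3/2):ℝ)) * ((closedBall (0:ℝ) (2^j)).indicator 1 v * h (t - 2 ^ k * v)) := by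
        refine lintegral_mono fun v => ?_
        simp_rw [← mul_assoc]
        rw [ENNReal.tsum_mul_right]
        gcongr
        exact ps_W_dyadic v
    _ = ∑' j : ℕ, ENNReal.ofReal (4 * ((2:ℝ)^j) ^ (-(3/2):ℝ)) * ∫⁻ v, (closedBall (0:ℝ) (2^j)).indicator 1 v * h (t - 2 ^ k * v) := by
        have hm : ∀ j : ℕ, Measurable fun v : ℝ => (closedBall (0:ℝ) (2^j)).indicator (1 : ℝ → ℝ≥0∞) v * h (t - 2 ^ k * v) := fun j =>
          (measurable_const.indicator measurableSet_closedBall).mul (hh.comp (by fun_prop))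
        rw [lintegral_tsum]
        · congr 1
          ext j
          rw [lintegral_const_mul _ (hm j)]
        · exact fun j => ((hm j).const_mul _).aemeasurable
    _ ≤ ∑' j : ℕ, (4 * ENNReal.ofReal ((2:ℝ)^(-(1/2):ℝ)) ^ j) * psMax h t := by
        refine ENNReal.tsum_le_tsum fun j => ?_
        refine (mul_le_mul_right (hb j) _).trans ?_
        rw [← mul_assoc]
        refine mul_le_mul_left (le_of_eq ?_) _
        rw [← ENNReal.ofReal_pow (by positivity), show (4:ℝ≥0∞) = ENNReal.ofReal 4 by simp, ← ENNReal.ofReal_mul (by positivity), ← ENNReal.ofReal_mul (by positivity)]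
        congr 1
        rw [mul_assoc]
        congr 1
        rw [← Real.rpow_natCast, ← Real.rpow_natCast, ← Real.rpow_mul (by norm_num), ← Real.rpow_mul (by norm_num), ← Real.rpow_add (by norm_num)]
        congr 1
        ring
    _ = _ := by rw [ENNReal.tsum_mul_right]

end PSSr

noncomputable section PSProd

/-- iterated maximal function -/
def psMM {n : ℕ} (g : Pt n → ℝ≥0∞) (z : Pt n) : ℝ≥0∞ :=
  psMax (fun x' : Spc n => psMax (fun t' : ℝ => g (t', x')) z.1) z.2

/-- weighted average at scale `2^k` -/
def psS {n : ℕ} (k : ℤ) (g : Pt n → ℝ≥0∞) (z : Pt n) : ℝ≥0∞ :=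
  ∫⁻ y in closedBall (0 : Spc n) 1, ∫⁻ v : ℝ, ENNReal.ofReal (psW v) * g (z.1 - ((2:ℝ)^k)^2 * v, z.2 + (2 * (2:ℝ)^k) • y)

lemma ps_H_meas {n : ℕ} {g : Pt n → ℝ≥0∞} (hg : Measurable g) :
    Measurable (fun z : Pt n => psMax (fun t' : ℝ => g (t', z.2)) z.1) := by
  unfold psMax
  refine Measurable.iSup fun k => ?_
  unfold psAvg
  apply Measurable.lintegral_prod_right' (f := fun w : Pt n × ℝ => g (w.1.1 + (2:ℝ)^k • w.2, w.1.2))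
  exact hg.comp (by fun_prop)

lemma ps_MM_meas {n : ℕ} {g : Pt n → ℝ≥0∞} (hg : Measurable g) : Measurable (psMM g) := by
  have hH := ps_H_meas hg
  have : psMM g = fun z : Pt n => ⨆ k : ℤ, ∫⁻ y in closedBall (0 : Spc n) 1, psMax (fun t' : ℝ => g (t', z.2 + (2:ℝ)^k • y)) z.1 := rfl
  rw [this]
  refine Measurable.iSup fun k => ?_
  apply Measurable.lintegral_prod_right' (f := fun w : Pt n × Spc n => psMax (fun t' : ℝ => g (t', w.1.2 + (2:ℝ)^k • w.2)) w.1.1)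
  exact hH.comp (g := fun z : Pt n => psMax (fun t' : ℝ => g (t', z.2)) z.1)
    (f := fun w : Pt n × Spc n => (w.1.1, w.1.2 + (2:ℝ)^k • w.2)) (by fun_prop)

lemma ps_MM_strong (n : ℕ) {p : ℝ} (hp : 1 < p) : ∃ C : ℝ≥0∞, C ≠ ∞ ∧ ∀ g : Pt n → ℝ≥0∞, Measurable g →
    ∫⁻ z, psMM g z ^ p ≤ C * ∫⁻ z, g z ^ p := by
  obtain ⟨C1, hC1, h1⟩ := ps_strong (E := ℝ) hp
  obtain ⟨C2, hC2, h2⟩ := ps_strong (E := Spc n) hp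
  refine ⟨C2 * C1, ENNReal.mul_ne_top hC2 hC1, fun g hg => ?_⟩
  have hH := ps_H_meas hg
  have hM := ps_MM_meas hg
  calc ∫⁻ z, psMM g z ^ p = ∫⁻ t : ℝ, ∫⁻ x : Spc n, psMM g (t, x) ^ p := by
        rw [Measure.volume_eq_prod, lintegral_prod _ (hM.pow_const p).aemeasurable]
    _ ≤ ∫⁻ t : ℝ, C2 * ∫⁻ x : Spc n, (psMax (fun t' : ℝ => g (t', x)) t) ^ p := by
        refine lintegral_mono fun t => ?_
        exact h2 (fun x => psMax (fun t' : ℝ => g (t', x)) t) (hH.comp (f := fun x : Spc n => (t, x)) (by fun_prop))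
    _ = C2 * ∫⁻ z : Pt n, (psMax (fun t' : ℝ => g (t', z.2)) z.1) ^ p := by
        rw [lintegral_const_mul' _ _ hC2, Measure.volume_eq_prod, lintegral_prod _ (hH.pow_const p).aemeasurable]
    _ = C2 * ∫⁻ x : Spc n, ∫⁻ t : ℝ, (psMax (fun t' : ℝ => g (t', x)) t) ^ p := by
        rw [Measure.volume_eq_prod, lintegral_prod_symm _ (hH.pow_const p).aemeasurable]
    _ ≤ C2 * ∫⁻ x : Spc n, C1 * ∫⁻ t : ℝ, g (t, x) ^ p := by
        gcongr with x
        exact h1 (fun t => g (t, x)) (hg.comp (by fun_prop))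
    _ = C2 * C1 * ∫⁻ z, g z ^ p := by
        rw [lintegral_const_mul' _ _ hC1, Measure.volume_eq_prod, lintegral_prod_symm _ (hg.pow_const p).aemeasurable, mul_assoc]

lemma ps_S_max (n : ℕ) : ∃ C : ℝ≥0∞, C ≠ ∞ ∧ ∀ g : Pt n → ℝ≥0∞, Measurable g → ∀ k z,
    psS k g z ≤ C * psMM g z := by
  obtain ⟨C, hC, h⟩ := ps_W_max
  refine ⟨C, hC, fun g hg k z => ?_⟩
  calc psS k g z ≤ ∫⁻ y in closedBall (0 : Spc n) 1, C * psMax (fun t' : ℝ => g (t', z.2 + (2 * (2:ℝ)^k) • y)) z.1 := by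
        refine lintegral_mono fun y => ?_
        have := h (fun t' : ℝ => g (t', z.2 + (2 * (2:ℝ)^k) • y)) (hg.comp (by fun_prop)) z.1 (k * 2)
        rw [zpow_mul] at this
        exact this
    _ = C * psAvg ((2:ℝ)^(k+1)) (fun x' : Spc n => psMax (fun t' : ℝ => g (t', x')) z.1) z.2 := by
        rw [lintegral_const_mul' _ _ hC, zpow_add_one₀ (by norm_num), mul_comm (2:ℝ)]
        rfl
    _ ≤ _ := by
        gcongr
        exact le_iSup (fun k : ℤ => psAvg ((2:ℝ)^k) (fun x' : Spc n => psMax (fun t' : ℝ => g (t', x')) z.1) z.2) (k+1)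

lemma ps_S_holder (n : ℕ) {p : ℝ} (hp : 1 < p) : ∃ C : ℝ≥0∞, C ≠ ∞ ∧ ∀ g : Pt n → ℝ≥0∞, Measurable g → ∀ k z,
    psS k g z ≤ C * (ENNReal.ofReal (((2:ℝ)^k) ^ (-((n:ℝ) + 2))) * ∫⁻ z, g z ^ p) ^ (1/p) := by
  set q := p.conjExponent
  have hpq : p.HolderConjugate q := Real.HolderConjugate.conjExponent hp
  have hq1 : 1 < q := hpq.symm.lt
  set Wq := (∫⁻ v : ℝ, ENNReal.ofReal (psW v) ^ q) ^ (1/q)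
  have hWq : Wq ≠ ∞ := by
    refine ENNReal.rpow_ne_top_of_nonneg (by positivity) ?_
    have : ∫⁻ v : ℝ, ENNReal.ofReal (psW v) ^ q ≤ ∫⁻ v : ℝ, ENNReal.ofReal (psW v) := by
      refine lintegral_mono fun v => ?_
      conv_rhs => rw [← ENNReal.rpow_one (ENNReal.ofReal (psW v))]
      exact ENNReal.rpow_le_rpow_of_exponent_ge (by simpa using ps_W_le_one v) hq1.le
    refine (this.trans_lt ?_).ne
    exact ps_W_integrable.lintegral_lt_top
  set Bq := (volume (closedBall (0 : Spc n) 1)) ^ (1/q)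
  have hBq : Bq ≠ ∞ := ENNReal.rpow_ne_top_of_nonneg (by positivity) measure_closedBall_lt_top.ne
  refine ⟨Bq * Wq, ENNReal.mul_ne_top hBq hWq, fun g hg k z => ?_⟩
  have h2 : (0:ℝ) < 2 ^ k := by positivity
  have hp0 : 0 < p := by linarith
  -- inner
  have hin : ∀ x : Spc n, ∫⁻ v : ℝ, ENNReal.ofReal (psW v) * g (z.1 - ((2:ℝ)^k)^2 * v, x) ≤
      Wq * (ENNReal.ofReal ((((2:ℝ)^k)^2)⁻¹) * ∫⁻ t : ℝ, g (t, x) ^ p) ^ (1/p) := by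
    intro x
    have hgx : Measurable fun t : ℝ => g (t, x) := hg.comp (by fun_prop)
    have := ENNReal.lintegral_mul_le_Lp_mul_Lq volume hpq.symm (f := fun v : ℝ => ENNReal.ofReal (psW v))
      (g := fun v : ℝ => g (z.1 - ((2:ℝ)^k)^2 * v, x)) (by
        have := ps_W_continuous.measurable
        fun_prop) (hgx.comp (g := fun t : ℝ => g (t, x)) (f := fun v : ℝ => z.1 - ((2:ℝ)^k)^2 * v) (by fun_prop)).aemeasurable
    refine this.trans (le_of_eq ?_)
    congr 2
    have e := ps_lintegral_affine (E := ℝ) (fun t => g (t, x) ^ p) (hgx.pow_const p) z.1 (r := ((2:ℝ)^k)^2) (by positivity)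
    simp only [Module.finrank_self, pow_one] at e
    rw [← e, ← lintegral_neg_eq_self]
    congr 1
    ext v
    simp only [smul_eq_mul, mul_neg, sub_eq_add_neg, neg_neg]
  set H : Spc n → ℝ≥0∞ := fun x => ∫⁻ t : ℝ, g (t, x) ^ p
  have hHm : Measurable H := by
    apply Measurable.lintegral_prod_right' (f := fun w : Spc n × ℝ => g (w.2, w.1) ^ p)
    exact (hg.pow_const p).comp (by fun_prop : Measurable fun w : Spc n × ℝ => (w.2, w.1))
  set F : Spc n → ℝ≥0∞ := fun y => (ENNReal.ofReal ((((2:ℝ)^k)^2)⁻¹) * H (z.2 + (2 * (2:ℝ)^k) • y)) ^ (1/p)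
  have hFm : Measurable F := by
    have : Measurable fun y => H (z.2 + (2 * (2:ℝ)^k) • y) := hHm.comp (by fun_prop)
    exact (this.const_mul _).pow_const _
  have hFp : ∫⁻ y in closedBall (0 : Spc n) 1, F y ^ p ≤ ENNReal.ofReal (((2:ℝ)^k) ^ (-((n:ℝ) + 2))) * ∫⁻ z, g z ^ p := by
    calc ∫⁻ y in closedBall (0 : Spc n) 1, F y ^ p ≤ ∫⁻ y, F y ^ p := setLIntegral_le_lintegral _ _
      _ = ∫⁻ y, ENNReal.ofReal ((((2:ℝ)^k)^2)⁻¹) * H (z.2 + (2 * (2:ℝ)^k) • y) := by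
          congr 1; ext y
          simp only [F]
          rw [← ENNReal.rpow_mul, one_div, inv_mul_cancel₀ hp0.ne', ENNReal.rpow_one]
      _ = ENNReal.ofReal ((((2:ℝ)^k)^2)⁻¹) * (ENNReal.ofReal (((2 * (2:ℝ)^k) ^ n)⁻¹) * ∫⁻ x, H x) := by
          rw [lintegral_const_mul' _ _ ENNReal.ofReal_ne_top, ps_lintegral_affine H hHm z.2 (by positivity)]
          simp
      _ = ENNReal.ofReal ((((2:ℝ)^k)^2)⁻¹ * ((2 * (2:ℝ)^k) ^ n)⁻¹) * ∫⁻ z, g z ^ p := by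
          rw [← mul_assoc, ← ENNReal.ofReal_mul (by positivity), Measure.volume_eq_prod,
            lintegral_prod_symm _ (hg.pow_const p).aemeasurable]
      _ ≤ _ := by
          gcongr
          rw [Real.rpow_neg h2.le, Real.rpow_add h2, Real.rpow_natCast, Real.rpow_ofNat, mul_inv, mul_comm]
          gcongr
          linarith
  calc psS k g z ≤ ∫⁻ y in closedBall (0 : Spc n) 1, Wq * F y := lintegral_mono fun y => hin _
    _ = Wq * ∫⁻ y in closedBall (0 : Spc n) 1, (1 : Spc n → ℝ≥0∞) y * F y := by
        rw [lintegral_const_mul' _ _ hWq]; simp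
    _ ≤ Wq * (Bq * (∫⁻ y in closedBall (0 : Spc n) 1, F y ^ p) ^ (1/p)) := by
        gcongr
        have := ENNReal.lintegral_mul_le_Lp_mul_Lq (volume.restrict (closedBall (0 : Spc n) 1)) hpq.symm (f := (1 : Spc n → ℝ≥0∞))
          (g := F) measurable_const.aemeasurable hFm.aemeasurable
        refine this.trans (le_of_eq ?_)
        simp [Bq]
    _ ≤ _ := by
        rw [← mul_assoc, mul_comm Wq]
        gcongr

end PSProd

noncomputable section PSDiff

lemma ps_pi_one : ∫ v, (psPi v : ℂ) = 1 := by
  have := ps_pi_fourier 0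
  rw [ps_fourier] at this
  simpa using this

def psG {n : ℕ} (φ : Pt n → ℂ) (z : Pt n) : ℝ := Real.sqrt (∑ i, ‖tdx φ i z‖ ^ 2)

def psg {n : ℕ} (φ : Pt n → ℂ) (z : Pt n) : ℝ≥0∞ := ENNReal.ofReal (psG φ z) + ‖halfDerivFun φ z‖ₑ

/-- the product measure for averages -/
def psMu (n : ℕ) : Measure (Spc n × ℝ) := (volume.restrict (closedBall (0 : Spc n) 1)).prod volume

instance (n : ℕ) : SFinite (psMu n) := by unfold psMu; infer_instance

def psQ {n : ℕ} (φ : Pt n → ℂ) (z : Pt n) (a b : ℝ) : ℂ :=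
  ∫ w, (psPi w.2 : ℂ) * φ (z.1 - a * w.2, z.2 + b • w.1) ∂(psMu n)

instance psFin (n : ℕ) : IsFiniteMeasure (volume.restrict (closedBall (0 : Spc n) 1)) :=
  ⟨by rw [Measure.restrict_apply_univ]; exact measure_closedBall_lt_top⟩

lemma ps_pi_mu (n : ℕ) : Integrable (fun w : Spc n × ℝ => (psPi w.2 : ℂ)) (psMu n) :=
  Integrable.comp_snd (f := fun v : ℝ => (psPi v : ℂ)) ps_pi_integrable.ofReal _

lemma ps_Q_integrable {n : ℕ} {φ : Pt n → ℂ} (h : Continuous φ) {M : ℝ} (hM : ∀ z, ‖φ z‖ ≤ M) (z : Pt n) (a b : ℝ) :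
    Integrable (fun w : Spc n × ℝ => (psPi w.2 : ℂ) * φ (z.1 - a * w.2, z.2 + b • w.1)) (psMu n) := by
  refine (ps_pi_mu n).mul_bdd (c := M) ?_ (Eventually.of_forall fun w => hM _)
  exact (h.comp (by fun_prop)).aestronglyMeasurable

lemma ps_pi_nonneg (v : ℝ) : 0 ≤ psPi v := by unfold psPi; positivity

lemma ps_Q_zero {n : ℕ} {φ : Pt n → ℂ} (h : Continuous φ) {M : ℝ} (hM : ∀ z, ‖φ z‖ ≤ M) (z : Pt n)
    {a b : ℕ → ℝ} (ha : Tendsto a atTop (𝓝 0)) (hb : Tendsto b atTop (𝓝 0)) :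
    Tendsto (fun k => psQ φ z (a k) (b k)) atTop (𝓝 ((volume.real (closedBall (0 : Spc n) 1) : ℂ) * φ z)) := by
  have e : (volume.real (closedBall (0 : Spc n) 1) : ℂ) * φ z = ∫ w : Spc n × ℝ, (psPi w.2 : ℂ) * φ z ∂(psMu n) := by
    rw [integral_mul_const]
    congr 1
    unfold psMu
    have := integral_prod_mul (μ := volume.restrict (closedBall (0 : Spc n) 1)) (ν := (volume : Measure ℝ)) (fun _ => (1:ℂ)) (fun v : ℝ => (psPi v : ℂ))
    simp only [one_mul] at this
    rw [this, ps_pi_one]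
    simp
  rw [e]
  unfold psQ
  refine tendsto_integral_of_dominated_convergence (fun w => ‖(psPi w.2 : ℂ)‖ * M) (fun k => (ps_Q_integrable h hM z _ _).1)
    ((ps_pi_mu n).norm.mul_const M) (fun k => Eventually.of_forall fun w => ?_) (Eventually.of_forall fun w => ?_)
  · rw [norm_mul]
    exact mul_le_mul_of_nonneg_left (hM _) (norm_nonneg _)
  · refine Tendsto.const_mul _ ?_
    have h1 : Tendsto (fun k => (z.1 - a k * w.2, z.2 + b k • w.1)) atTop (𝓝 (z.1 - 0 * w.2, z.2 + (0:ℝ) • w.1)) :=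
      Tendsto.prodMk_nhds (tendsto_const_nhds.sub (ha.mul_const _)) (tendsto_const_nhds.add (hb.smul_const _))
    rw [zero_mul, sub_zero, zero_smul, add_zero] at h1
    exact (h.tendsto _).comp h1

lemma ps_Q_top {n : ℕ} {φ : Pt n → ℂ} (h : Continuous φ) {M : ℝ} (hM : ∀ z, ‖φ z‖ ≤ M) {R : ℝ}
    (hR : ∀ t x, R < |t| ∨ R < ‖x‖ → φ (t, x) = 0) (z : Pt n)
    {a b : ℕ → ℝ} (ha : Tendsto a atTop atTop) :
    Tendsto (fun k => psQ φ z (a k) (b k)) atTop (𝓝 0) := by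
  have e : (0:ℂ) = ∫ w : Spc n × ℝ, (0 : ℂ) ∂(psMu n) := by simp
  rw [e]
  unfold psQ
  refine tendsto_integral_of_dominated_convergence (fun w => ‖(psPi w.2 : ℂ)‖ * M) (fun k => (ps_Q_integrable h hM z _ _).1)
    ((ps_pi_mu n).norm.mul_const M) (fun k => Eventually.of_forall fun w => ?_) ?_
  · rw [norm_mul]
    exact mul_le_mul_of_nonneg_left (hM _) (norm_nonneg _)
  · have hae : ∀ᵐ w ∂(psMu n), w.2 ≠ 0 :=
      Measure.quasiMeasurePreserving_snd.ae (p := fun v : ℝ => v ≠ 0) (by simp [ae_iff])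
    filter_upwards [hae] with w hw
    refine tendsto_const_nhds.congr' ?_
    have h2 : Tendsto (fun k => a k * |w.2|) atTop atTop := ha.atTop_mul_const (abs_pos.2 hw)
    filter_upwards [h2.eventually_gt_atTop (R + |z.1|), ha.eventually_ge_atTop 0] with k hk hk0
    rw [hR, mul_zero]
    left
    have h3 := abs_sub_abs_le_abs_sub (a k * w.2) z.1
    rw [abs_mul, abs_of_nonneg hk0, abs_sub_comm] at h3
    linarith

lemma ps_enorm_time {n : ℕ} {φ : Pt n → ℂ} (h : ContDiff ℝ (⊤:ℕ∞) φ) (hc : HasCompactSupport φ) (z : Pt n) (k : ℤ) :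
    ‖psQ φ z (((2:ℝ)^k)^2) (2 * 2^k) - psQ φ z (4 * ((2:ℝ)^k)^2) (2 * 2^k)‖ₑ ≤
      180 * ENNReal.ofReal (2^k) * psS k (fun z => ‖halfDerivFun φ z‖ₑ) z := by
  obtain ⟨M, hM⟩ := h.continuous.bounded_above_of_compact_support hc
  set r : ℝ := 2 ^ k with hr
  have hr0 : 0 < r := by positivity
  have i1 := ps_Q_integrable h.continuous hM z (r^2) (2 * r)
  have i2 := ps_Q_integrable h.continuous hM z (4 * r^2) (2 * r)
  unfold psQ
  unfold psMu at i1 i2 ⊢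
  rw [integral_prod _ i1, integral_prod _ i2, ← integral_sub i1.integral_prod_left i2.integral_prod_left]
  have e : ∀ y : Spc n, (∫ v : ℝ, (psPi v : ℂ) * φ (z.1 - r^2 * v, z.2 + (2*r) • y)) - (∫ v : ℝ, (psPi v : ℂ) * φ (z.1 - (4 * r^2) * v, z.2 + (2*r) • y)) =
      (√(r^2) : ℂ) * ∫ v, psK v * halfDerivFun φ (z.1 - r^2 * v, z.2 + (2*r) • y) := by
    intro y
    obtain ⟨h1, h2⟩ := ps_slice h hc (z.2 + (2*r) • y)
    obtain ⟨a1, a2, a3, a4⟩ := ps_test_fourier h1 h2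
    exact ps_time_identity a1 a2 a3 a4 z.1 (s := r^2) (by positivity)
  simp only [e]
  rw [Real.sqrt_sq hr0.le]
  refine (enorm_integral_le_lintegral_enorm _).trans ?_
  unfold psS
  rw [← hr, ← lintegral_const_mul' _ _ (ENNReal.mul_ne_top (by simp) (by simp))]
  refine lintegral_mono fun y => ?_
  rw [enorm_mul, ← lintegral_const_mul' _ _ (ENNReal.mul_ne_top (by simp) (by simp))]
  refine (mul_le_mul_right (enorm_integral_le_lintegral_enorm _) _).trans ?_
  rw [← lintegral_const_mul' _ _ (by simp)]
  refine lintegral_mono fun v => ?_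
  simp only
  rw [enorm_mul]
  have h5 : ‖psK v‖ₑ ≤ 180 * ENNReal.ofReal (psW v) := by
    rw [← ofReal_norm, show (180:ℝ≥0∞) = ENNReal.ofReal 180 by simp, ← ENNReal.ofReal_mul (by norm_num)]
    exact ENNReal.ofReal_le_ofReal (ps_K_bound v)
  have h6 : ‖(r:ℂ)‖ₑ = ENNReal.ofReal r := by
    rw [← ofReal_norm, Complex.norm_real, Real.norm_of_nonneg hr0.le]
  rw [h6]
  calc ENNReal.ofReal r * (‖psK v‖ₑ * _) ≤ ENNReal.ofReal r * ((180 * ENNReal.ofReal (psW v)) * _) := by gcongr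
    _ = _ := by ring

lemma ps_grad_bound {n : ℕ} (φ : Pt n → ℂ) (z : Pt n) (w : Spc n) :
    ‖fderiv ℝ φ z ((0:ℝ), w)‖ ≤ ‖w‖ * (n * psG φ z) := by
  have h1 : ((0:ℝ), w) = ∑ i, w i • ((0:ℝ), (Pi.single i (1:ℝ) : Spc n)) := by
    refine Prod.ext ?_ ?_
    · simp [Prod.fst_sum]
    · rw [Prod.snd_sum]
      simp only [Prod.smul_snd]
      exact pi_eq_sum_univ' w
  rw [h1, map_sum]
  have h2 : ∀ i, ‖tdx φ i z‖ ≤ psG φ z := by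
    intro i
    unfold psG
    apply Real.le_sqrt_of_sq_le
    exact Finset.single_le_sum (f := fun i => ‖tdx φ i z‖ ^ 2) (fun j _ => by positivity) (Finset.mem_univ i)
  refine (norm_sum_le _ _).trans ?_
  calc ∑ i, ‖fderiv ℝ φ z (w i • ((0:ℝ), (Pi.single i (1:ℝ) : Spc n)))‖ ≤ ∑ i : Fin n, ‖w‖ * psG φ z := by
        refine Finset.sum_le_sum fun i _ => ?_
        rw [map_smul, norm_smul]
        exact mul_le_mul (norm_le_pi_norm w i) (h2 i) (norm_nonneg _) (norm_nonneg _)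
    _ = _ := by simp; ring

lemma ps_G_continuous {n : ℕ} {φ : Pt n → ℂ} (h : ContDiff ℝ (⊤:ℕ∞) φ) : Continuous (psG φ) := by
  unfold psG tdx
  have : Continuous (fderiv ℝ φ) := h.continuous_fderiv (by simp)
  fun_prop

lemma ps_ftc {n : ℕ} {φ : Pt n → ℂ} (h : ContDiff ℝ (⊤:ℕ∞) φ) (t : ℝ) (x w : Spc n) {r : ℝ} (hr : 0 < r) (hw : ‖w‖ ≤ 1) :
    ‖φ (t, x + r • w) - φ (t, x + (2 * r) • w)‖ₑ ≤
      ∫⁻ θ in Icc (1:ℝ) 2, ENNReal.ofReal (r * n) * ENNReal.ofReal (psG φ (t, x + (θ * r) • w)) := by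
  have hd : ∀ θ : ℝ, HasDerivAt (fun θ : ℝ => φ (t, x + (θ * r) • w)) (fderiv ℝ φ (t, x + (θ * r) • w) ((0:ℝ), r • w)) θ := by
    intro θ
    have h1 : HasFDerivAt φ (fderiv ℝ φ (t, x + (θ * r) • w)) (t, x + (θ * r) • w) :=
      (h.differentiable (by simp) _).hasFDerivAt
    have h2 : HasDerivAt (fun θ : ℝ => ((t, x + (θ * r) • w) : Pt n)) ((0:ℝ), r • w) θ := by
      refine HasDerivAt.prodMk (hasDerivAt_const _ _) ?_
      have := (((hasDerivAt_id θ).mul_const r).smul_const w).const_add x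
      simpa using this
    exact h1.comp_hasDerivAt θ h2
  have hcont : Continuous fun θ : ℝ => fderiv ℝ φ (t, x + (θ * r) • w) ((0:ℝ), r • w) := by
    have : Continuous (fderiv ℝ φ) := h.continuous_fderiv (by simp)
    fun_prop
  have := intervalIntegral.integral_eq_sub_of_hasDerivAt (a := 1) (b := 2) (fun θ _ => hd θ) (hcont.intervalIntegrable _ _)
  simp only [one_mul] at this
  rw [← enorm_neg, neg_sub, ← this, intervalIntegral.integral_of_le (by norm_num), ← integral_Icc_eq_integral_Ioc]
  refine (enorm_integral_le_lintegral_enorm _).trans (lintegral_mono fun θ => ?_)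
  rw [← ofReal_norm, ← ENNReal.ofReal_mul (by positivity)]
  apply ENNReal.ofReal_le_ofReal
  refine (ps_grad_bound φ _ _).trans ?_
  rw [norm_smul, Real.norm_of_nonneg hr.le]
  have hG : 0 ≤ psG φ (t, x + (θ * r) • w) := Real.sqrt_nonneg _
  calc r * ‖w‖ * (n * psG φ (t, x + (θ * r) • w)) ≤ r * 1 * (n * psG φ (t, x + (θ * r) • w)) := by gcongr
    _ = _ := by ring

lemma ps_avg_le {n : ℕ} (f : Spc n → ℝ≥0∞) (hf : Measurable f) (x : Spc n) {r θ : ℝ} (hr : 0 < r) (hθ : θ ∈ Icc (1:ℝ) 2) :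
    psAvg (θ * r) f x ≤ 2 ^ n * psAvg (2 * r) f x := by
  have h1 := hθ.1
  have h2 := hθ.2
  rw [ps_avg_eq f hf x (by positivity), ps_avg_eq f hf x (by positivity), ← mul_assoc]
  have e : (2:ℝ≥0∞) ^ n * ENNReal.ofReal (((2 * r) ^ Module.finrank ℝ (Spc n))⁻¹) = ENNReal.ofReal ((r ^ n)⁻¹) := by
    rw [show (2:ℝ≥0∞) ^ n = ENNReal.ofReal (2 ^ n) by rw [ENNReal.ofReal_pow (by norm_num)]; simp, ← ENNReal.ofReal_mul (by positivity)]
    congr 1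
    simp only [Module.finrank_fin_fun, mul_pow]
    field_simp
  rw [e]
  refine mul_le_mul' (ENNReal.ofReal_le_ofReal ?_) (lintegral_mono_set (closedBall_subset_closedBall (by nlinarith)))
  simp only [Module.finrank_fin_fun]
  gcongr
  nlinarith

lemma ps_enorm_space {n : ℕ} {φ : Pt n → ℂ} (h : ContDiff ℝ (⊤:ℕ∞) φ) (hc : HasCompactSupport φ) (z : Pt n) (k : ℤ) :
    ‖psQ φ z (((2:ℝ)^k)^2) (2^k) - psQ φ z (((2:ℝ)^k)^2) (2 * 2^k)‖ₑ ≤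
      (180 * n * 2 ^ n) * ENNReal.ofReal (2^k) * psS k (fun z => ENNReal.ofReal (psG φ z)) z := by
  obtain ⟨M, hM⟩ := h.continuous.bounded_above_of_compact_support hc
  set r : ℝ := 2 ^ k with hr
  have hr0 : 0 < r := by positivity
  have i1 := ps_Q_integrable h.continuous hM z (r^2) r
  have i2 := ps_Q_integrable h.continuous hM z (r^2) (2 * r)
  have hG := (ps_G_continuous h).measurable
  have hpi := ps_continuous_pi.measurable
  unfold psQ
  rw [← integral_sub i1 i2]
  refine (enorm_integral_le_lintegral_enorm _).trans ?_
  set B := closedBall (0 : Spc n) 1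
  have hS : psS k (fun z => ENNReal.ofReal (psG φ z)) z = ∫⁻ v : ℝ, ENNReal.ofReal (psW v) * psAvg (2 * r) (fun x => ENNReal.ofReal (psG φ (z.1 - r^2 * v, x))) z.2 := by
    unfold psS
    rw [lintegral_lintegral_swap]
    · congr 1
      ext v
      rw [lintegral_const_mul' _ _ (by simp)]
      rfl
    · have := ps_W_continuous.measurable
      apply Measurable.aemeasurable
      unfold Function.uncurry
      fun_prop
  rw [hS]
  have hm1 : Measurable fun w : Spc n × ℝ => ‖(psPi w.2 : ℂ) * φ (z.1 - r^2 * w.2, z.2 + r • w.1) - (psPi w.2 : ℂ) * φ (z.1 - r^2 * w.2, z.2 + (2*r) • w.1)‖ₑ := by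
    have := h.continuous.measurable
    fun_prop
  unfold psMu
  rw [lintegral_prod_symm _ hm1.aemeasurable, ← lintegral_const_mul' _ _ (ENNReal.mul_ne_top (ENNReal.mul_ne_top (ENNReal.mul_ne_top (by simp) (by simp)) (by simp)) (by simp))]
  refine lintegral_mono fun v => ?_
  simp only
  have h1 : ∫⁻ y in B, ‖(psPi v : ℂ) * φ (z.1 - r^2 * v, z.2 + r • y) - (psPi v : ℂ) * φ (z.1 - r^2 * v, z.2 + (2*r) • y)‖ₑ ≤
      ∫⁻ y in B, ∫⁻ θ in Icc (1:ℝ) 2, ENNReal.ofReal (psPi v) * ENNReal.ofReal (r * n) * ENNReal.ofReal (psG φ (z.1 - r^2 * v, z.2 + (θ * r) • y)) := by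
    refine setLIntegral_mono' measurableSet_closedBall fun y hy => ?_
    rw [← mul_sub, enorm_mul, ← ofReal_norm, Complex.norm_real, Real.norm_of_nonneg (ps_pi_nonneg v)]
    simp_rw [mul_assoc]
    rw [lintegral_const_mul' _ _ (by simp)]
    refine mul_le_mul_right ?_ _
    exact ps_ftc h _ _ _ hr0 (mem_closedBall_zero_iff.1 hy)
  refine h1.trans ?_
  rw [lintegral_lintegral_swap (by
    apply Measurable.aemeasurable
    unfold Function.uncurry
    fun_prop)]
  have h2 : ∀ θ ∈ Icc (1:ℝ) 2, ∫⁻ y in B, ENNReal.ofReal (psPi v) * ENNReal.ofReal (r * n) * ENNReal.ofReal (psG φ (z.1 - r^2 * v, z.2 + (θ * r) • y)) ≤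
      ENNReal.ofReal (psPi v) * ENNReal.ofReal (r * n) * (2 ^ n * psAvg (2 * r) (fun x => ENNReal.ofReal (psG φ (z.1 - r^2 * v, x))) z.2) := by
    intro θ hθ
    rw [lintegral_const_mul' _ _ (ENNReal.mul_ne_top (by simp) (by simp))]
    refine mul_le_mul_right ?_ _
    exact ps_avg_le (fun x => ENNReal.ofReal (psG φ (z.1 - r^2 * v, x))) (by fun_prop) z.2 hr0 hθ
  refine (setLIntegral_mono' measurableSet_Icc h2).trans ?_
  rw [setLIntegral_const, Real.volume_Icc, show ENNReal.ofReal ((2:ℝ) - 1) = 1 by norm_num, mul_one]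
  have h3 : ENNReal.ofReal (psPi v) ≤ 180 * ENNReal.ofReal (psW v) := by
    rw [show (180:ℝ≥0∞) = ENNReal.ofReal 180 by simp, ← ENNReal.ofReal_mul (by norm_num)]
    exact ENNReal.ofReal_le_ofReal (ps_pi_bound v)
  rw [ENNReal.ofReal_mul hr0.le, ENNReal.ofReal_natCast]
  refine (mul_le_mul_left (mul_le_mul_left h3 _) _).trans (le_of_eq ?_)
  ring

lemma ps_S_mono {n : ℕ} {g g' : Pt n → ℝ≥0∞} (h : ∀ z, g z ≤ g' z) (k : ℤ) (z : Pt n) : psS k g z ≤ psS k g' z := by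
  unfold psS
  refine lintegral_mono fun y => lintegral_mono fun v => ?_
  exact mul_le_mul_right (h _) _

/-- the averages at dyadic scales -/
def psP {n : ℕ} (φ : Pt n → ℂ) (z : Pt n) (k : ℤ) : ℂ := psQ φ z (((2:ℝ)^k)^2) (2^k)

lemma ps_P_diff {n : ℕ} {φ : Pt n → ℂ} (h : ContDiff ℝ (⊤:ℕ∞) φ) (hc : HasCompactSupport φ) (z : Pt n) (k : ℤ) :
    ‖psP φ z k - psP φ z (k+1)‖ₑ ≤ (180 * n * 2 ^ n + 180) * ENNReal.ofReal (2^k) * psS k (psg φ) z := by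
  have e : psP φ z (k+1) = psQ φ z (4 * ((2:ℝ)^k)^2) (2 * 2^k) := by
    unfold psP
    rw [zpow_add_one₀ (by norm_num)]
    congr 1 <;> ring
  rw [e]
  have h1 := ps_enorm_space h hc z k
  have h2 := ps_enorm_time h hc z k
  have m1 := ps_S_mono (g := fun z => ENNReal.ofReal (psG φ z)) (g' := psg φ) (fun z => le_self_add) k z
  have m2 := ps_S_mono (g := fun z => ‖halfDerivFun φ z‖ₑ) (g' := psg φ) (fun z => le_add_self) k z
  have : psP φ z k - psQ φ z (4 * ((2:ℝ)^k)^2) (2 * 2^k) =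
    (psQ φ z (((2:ℝ)^k)^2) (2^k) - psQ φ z (((2:ℝ)^k)^2) (2 * 2^k)) + (psQ φ z (((2:ℝ)^k)^2) (2 * 2^k) - psQ φ z (4 * ((2:ℝ)^k)^2) (2 * 2^k)) := by
    unfold psP; ring
  rw [this]
  refine (enorm_add_le _ _).trans ((add_le_add (h1.trans (mul_le_mul_right m1 _)) (h2.trans (mul_le_mul_right m2 _))).trans (le_of_eq ?_))
  ring

end PSDiff

noncomputable section PSFinal

lemma ps_bochner {n : ℕ} {f : Pt n → ℝ} (hf : Measurable f) (h0 : ∀ z, 0 ≤ f z) {p : ℝ} (hp : 0 < p) :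
    (∫ z, f z ^ p) ^ (1/p) = ((∫⁻ z, ENNReal.ofReal (f z) ^ p) ^ (1/p)).toReal := by
  rw [integral_eq_lintegral_of_nonneg_ae (Eventually.of_forall fun z => Real.rpow_nonneg (h0 z) p) (hf.pow_const p).aestronglyMeasurable,
    ← ENNReal.toReal_rpow]
  congr 3
  ext z
  rw [ENNReal.ofReal_rpow_of_nonneg (h0 z) hp.le]

lemma ps_lint_ne_top {n : ℕ} {f : Pt n → ℝ} (h0 : ∀ z, 0 ≤ f z) {p : ℝ} (hp : 0 < p)
    (hi : Integrable (fun z => f z ^ p)) : (∫⁻ z, ENNReal.ofReal (f z) ^ p) ≠ ∞ := by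
  have := hi.lintegral_lt_top
  refine ne_of_lt (lt_of_le_of_lt (le_of_eq ?_) this)
  congr 1
  ext z
  rw [ENNReal.ofReal_rpow_of_nonneg (h0 z) hp.le]

lemma ps_G_integrable {n : ℕ} {φ : Pt n → ℂ} (h : ContDiff ℝ (⊤:ℕ∞) φ) (hc : HasCompactSupport φ) {p : ℝ} (hp : 1 < p) :
    Integrable (fun z => psG φ z ^ p) := by
  refine Continuous.integrable_of_hasCompactSupport ?_ ?_
  · exact (ps_G_continuous h).rpow_const fun _ => Or.inr (by linarith)
  · have h1 : HasCompactSupport (fderiv ℝ φ) := hc.fderiv ℝ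
    refine h1.mono ?_
    intro z hz hz2
    apply hz
    simp [psG, tdx, hz2, Real.zero_rpow (by linarith : p ≠ 0)]

lemma ps_g_meas {n : ℕ} {φ : Pt n → ℂ} (h : ContDiff ℝ (⊤:ℕ∞) φ) (hc : HasCompactSupport φ) : Measurable (psg φ) := by
  have h1 := (ps_G_continuous h).measurable
  have h2 := ps_half_meas h hc
  unfold psg
  fun_prop

lemma ps_pointwise (n : ℕ) {p : ℝ} (hp1 : 1 < p) (hp2 : p < (n:ℝ) + 2) : ∃ K : ℝ, 0 ≤ K ∧
    ∀ φ : Pt n → ℂ, ContDiff ℝ (⊤:ℕ∞) φ → HasCompactSupport φ → (∫⁻ z, psg φ z ^ p) ≠ ∞ →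
      ∀ z, psMM (psg φ) z ≠ ∞ → ‖φ z‖ₑ ≤ ENNReal.ofReal K * (psMM (psg φ) z ^ (1 - p / (n+2)) * ((∫⁻ z, psg φ z ^ p) ^ (1/p)) ^ (p/(n+2))) := by
  obtain ⟨C1, hC1, H1⟩ := ps_S_max n
  obtain ⟨C2, hC2, H2⟩ := ps_S_holder n hp1
  have hp0 : 0 < p := by linarith
  set D : ℝ := (n+2)/p with hD
  have hD1 : 1 < D := by rw [hD, one_lt_div hp0]; exact hp2
  have hDi : D⁻¹ = p / (n+2) := by rw [hD, inv_div]
  set ρ : ℝ := 2 ^ (1 - D) with hρ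
  have hρ0 : 0 < ρ := by positivity
  have hρ1 : ρ < 1 := Real.rpow_lt_one_of_one_lt_of_neg (by norm_num) (by linarith)
  set c0 : ℝ≥0∞ := 180 * n * 2 ^ n + 180
  have hc0 : c0 ≠ ∞ := by
    refine ENNReal.add_ne_top.2 ⟨ENNReal.mul_ne_top (ENNReal.mul_ne_top (by simp) (by simp)) (by simp), by simp⟩
  set K0 : ℝ := (c0 * (C1 + C2)).toReal
  have hK0t : c0 * (C1 + C2) ≠ ∞ := ENNReal.mul_ne_top hc0 (ENNReal.add_ne_top.2 ⟨hC1, hC2⟩)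
  have hK0 : 0 ≤ K0 := ENNReal.toReal_nonneg
  set b : ℝ := volume.real (closedBall (0 : Spc n) 1)
  have hb : 0 < b := ENNReal.toReal_pos (measure_closedBall_pos _ _ one_pos).ne' measure_closedBall_lt_top.ne
  have h1ρ : 0 < 1 - ρ := by linarith
  refine ⟨b⁻¹ * ((K0 / (1 - ρ)) * (1 + 2 ^ (D - 1))), by positivity, fun φ h hc hA z hM => ?_⟩
  have hgm := ps_g_meas h hc
  set A : ℝ≥0∞ := (∫⁻ z, psg φ z ^ p) ^ (1/p) with hAdef
  have hAt : A ≠ ∞ := ENNReal.rpow_ne_top_of_nonneg (by positivity) hA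
  set M : ℝ≥0∞ := psMM (psg φ) z
  obtain ⟨R, hR1, hR⟩ := ps_radius hc
  obtain ⟨Mφ, hMφ⟩ := h.continuous.bounded_above_of_compact_support hc
  have hpow : ∀ k : ℤ, ((2:ℝ)^k) ^ (1 - D) = ρ ^ k := by
    intro k
    rw [hρ, ← Real.rpow_intCast, ← Real.rpow_intCast, ← Real.rpow_mul (by norm_num), ← Real.rpow_mul (by norm_num), mul_comm]
  have hS1 : ∀ k : ℤ, ‖psP φ z k - psP φ z (k+1)‖ ≤ 2 ^ k * (K0 * M.toReal) := by
    intro k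
    have h1 : ‖psP φ z k - psP φ z (k+1)‖ₑ ≤ ENNReal.ofReal (2^k) * (c0 * (C1 + C2) * M) := by
      refine (ps_P_diff h hc z k).trans ?_
      calc c0 * ENNReal.ofReal (2^k) * psS k (psg φ) z ≤ c0 * ENNReal.ofReal (2^k) * ((C1 + C2) * M) := by
            gcongr
            exact (H1 _ hgm k z).trans (by gcongr; exact le_self_add)
        _ = _ := by ring
    have h2 := ENNReal.toReal_mono (ENNReal.mul_ne_top (by simp) (ENNReal.mul_ne_top hK0t hM)) h1
    rw [toReal_enorm, ENNReal.toReal_mul, ENNReal.toReal_mul, ENNReal.toReal_ofReal (by positivity)] at h2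
    exact h2
  have hS2 : ∀ k : ℤ, ‖psP φ z k - psP φ z (k+1)‖ ≤ ρ ^ k * (K0 * A.toReal) := by
    intro k
    have h2k : (0:ℝ) < 2 ^ k := by positivity
    have h1 : ‖psP φ z k - psP φ z (k+1)‖ₑ ≤ ENNReal.ofReal (ρ^k) * (c0 * (C1 + C2) * A) := by
      refine (ps_P_diff h hc z k).trans ?_
      have e1 : ENNReal.ofReal (ρ^k) = ENNReal.ofReal (2^k) * ENNReal.ofReal (((2:ℝ)^k) ^ (-((n:ℝ) + 2))) ^ (1/p) := by
        rw [ENNReal.ofReal_rpow_of_nonneg (by positivity) (by positivity), ← ENNReal.ofReal_mul (by positivity), ← hpow,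
          ← Real.rpow_mul (by positivity), Real.rpow_sub h2k, Real.rpow_one, div_eq_mul_inv, ← Real.rpow_neg h2k.le]
        congr 3
        rw [hD]; ring
      calc c0 * ENNReal.ofReal (2^k) * psS k (psg φ) z ≤ c0 * ENNReal.ofReal (2^k) * ((C1 + C2) * (ENNReal.ofReal (((2:ℝ)^k) ^ (-((n:ℝ) + 2))) ^ (1/p) * A)) := by
            gcongr
            rw [hAdef, ← ENNReal.mul_rpow_of_nonneg _ _ (by positivity)]
            exact (H2 _ hgm k z).trans (by gcongr; exact le_add_self)
        _ = _ := by rw [e1]; ring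
    have h2 := ENNReal.toReal_mono (ENNReal.mul_ne_top (by simp) (ENNReal.mul_ne_top hK0t hAt)) h1
    rw [toReal_enorm, ENNReal.toReal_mul, ENNReal.toReal_mul, ENNReal.toReal_ofReal (by positivity)] at h2
    exact h2
  have hhalf : Tendsto (fun k : ℕ => (2:ℝ) ^ (-(k:ℤ))) atTop (𝓝 0) := by
    have := tendsto_pow_atTop_nhds_zero_of_lt_one (r := (1/2:ℝ)) (by norm_num) (by norm_num)
    refine this.congr fun k => ?_
    rw [zpow_neg, zpow_natCast, one_div, inv_pow]
  have hl0 : Tendsto (fun k : ℕ => psP φ z (-(k:ℤ))) atTop (𝓝 ((b:ℂ) * φ z)) := by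
    refine ps_Q_zero h.continuous hMφ z ?_ hhalf
    have := hhalf.pow 2
    simpa using this
  have hl1 : Tendsto (fun k : ℕ => psP φ z k) atTop (𝓝 0) := by
    refine ps_Q_top h.continuous hMφ hR z ?_
    have h2 : Tendsto (fun k : ℕ => (2:ℝ) ^ (k:ℤ)) atTop atTop := by
      simp_rw [zpow_natCast]
      exact tendsto_pow_atTop_atTop_of_one_lt (by norm_num)
    exact (tendsto_pow_atTop (by norm_num)).comp h2
  have hfin := ps_hed (a := ‖(b:ℂ) * φ z‖) (C := K0 / (1 - ρ)) (M := M.toReal) (A := A.toReal) (D := D)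
    ENNReal.toReal_nonneg ENNReal.toReal_nonneg (by positivity) hD1 (fun m => by
      refine (ps_tele hl0 hl1 hρ0 hρ1 hS1 hS2 m).trans ?_
      rw [hpow]
      have hMt : 0 ≤ M.toReal := ENNReal.toReal_nonneg
      have : (2:ℝ)^m * (K0 * M.toReal) ≤ (2:ℝ)^m * (K0 * M.toReal) / (1 - ρ) := by
        rw [le_div_iff₀ h1ρ]
        have : 0 ≤ (2:ℝ)^m * (K0 * M.toReal) := by positivity
        nlinarith
      refine (add_le_add_left this _).trans (le_of_eq ?_)
      ring)
  rw [norm_mul, Complex.norm_real, Real.norm_of_nonneg hb.le] at hfin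
  have hfin2 : ‖φ z‖ ≤ b⁻¹ * (K0 / (1 - ρ) * (1 + 2 ^ (D - 1))) * (M.toReal ^ (1 - D⁻¹) * A.toReal ^ D⁻¹) := by
    rw [mul_assoc, ← div_eq_inv_mul, le_div_iff₀ hb, mul_comm]
    exact hfin
  rw [hDi] at hfin2
  have hpn : p / (n + 2) < 1 := by rw [div_lt_one (by positivity)]; exact hp2
  have hpn0 : 0 ≤ p / ((n:ℝ) + 2) := by positivity
  rw [← ofReal_norm]
  refine (ENNReal.ofReal_le_ofReal hfin2).trans (le_of_eq ?_)
  have hDD : (0:ℝ) ≤ 2 ^ (D - 1) := by positivity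
  rw [ENNReal.ofReal_mul (by positivity)]
  congr 1
  rw [ENNReal.ofReal_mul (by positivity), ← ENNReal.ofReal_rpow_of_nonneg ENNReal.toReal_nonneg (by linarith),
    ← ENNReal.ofReal_rpow_of_nonneg ENNReal.toReal_nonneg hpn0, ENNReal.ofReal_toReal hM, ENNReal.ofReal_toReal hAt]

end PSFinal

noncomputable section

/-- parabolic Sobolev embedding, Lemma 1: for `1 < p < n+2` and all
`φ ∈ C₀^∞(ℝ^{n+1})`, `‖φ‖_{p*} ≲ ‖∇_x φ‖_p + ‖D_t^{1/2} φ‖_p`. -/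
theorem parabolic_sobolev_embedding
    (n : ℕ) (hn : 0 < n) (p : ℝ) (hp1 : 1 < p) (hp2 : p < (n : ℝ) + 2) :
    ∃ C : ℝ, 0 < C ∧
      ∀ φ : Pt n → ℂ, ContDiff ℝ (⊤:ℕ∞) φ → HasCompactSupport φ →
        (∫ z, ‖φ z‖ ^ pUp p n) ^ (1 / pUp p n)
          ≤ C * ((∫ z, (Real.sqrt (∑ i, ‖tdx φ i z‖ ^ 2)) ^ p) ^ (1/p)
               + (∫ z, ‖halfDerivFun φ z‖ ^ p) ^ (1/p)) := by
  obtain ⟨K, hK, HK⟩ := ps_pointwise n hp1 hp2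
  obtain ⟨C3, hC3, H3⟩ := ps_MM_strong n hp1
  have hp0 : 0 < p := by linarith
  have hn2 : (0:ℝ) < n + 2 := by positivity
  set q := pUp p n with hq
  have hqi : q⁻¹ = p⁻¹ - ((n : ℝ) + 2)⁻¹ := by rw [hq, pUp, inv_inv]
  have hqi0 : 0 < q⁻¹ := by
    rw [hqi, sub_pos]
    exact inv_strictAnti₀ hp0 hp2
  have hq0 : 0 < q := inv_pos.1 hqi0
  have hqp : (1 - p / (n+2)) * q = p := by
    have : (1 - p / (n+2)) = p * q⁻¹ := by rw [hqi]; field_simp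
    rw [this]; field_simp
  have hqA : p / (n+2) * q + p = q := by linarith
  have hpn0 : 0 ≤ p / ((n:ℝ) + 2) := by positivity
  set Cc : ℝ≥0∞ := ENNReal.ofReal K * C3 ^ (1/q)
  have hCc : Cc ≠ ∞ := ENNReal.mul_ne_top (by simp) (ENNReal.rpow_ne_top_of_nonneg (by positivity) hC3)
  refine ⟨Cc.toReal + 1, by positivity, fun φ h hc => ?_⟩
  have hGm := (ps_G_continuous h).measurable
  have hDm := ps_half_meas h hc
  have hgm := ps_g_meas h hc
  have hG0 : ∀ z, 0 ≤ psG φ z := fun z => Real.sqrt_nonneg _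
  have hIG := ps_lint_ne_top hG0 hp0 (ps_G_integrable h hc hp1)
  have hID := ps_lint_ne_top (fun z => norm_nonneg (halfDerivFun φ z)) hp0 (ps_half_integrable h hc hp1)
  have e1 := ps_bochner (f := fun z => ‖φ z‖) h.continuous.norm.measurable (fun z => norm_nonneg _) hq0
  have e2 := ps_bochner hGm hG0 hp0
  have e3 := ps_bochner (f := fun z => ‖halfDerivFun φ z‖) hDm.norm (fun z => norm_nonneg _) hp0
  have e2' : (∫ z, (Real.sqrt (∑ i, ‖tdx φ i z‖ ^ 2)) ^ p) ^ (1/p) = ((∫⁻ z, ENNReal.ofReal (psG φ z) ^ p) ^ (1/p)).toReal := e2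
  rw [e1, e2', e3]
  set AG := (∫⁻ z, ENNReal.ofReal (psG φ z) ^ p) ^ (1/p)
  set AD := (∫⁻ z, ENNReal.ofReal ‖halfDerivFun φ z‖ ^ p) ^ (1/p)
  have hAG : AG ≠ ∞ := ENNReal.rpow_ne_top_of_nonneg (by positivity) hIG
  have hAD : AD ≠ ∞ := ENNReal.rpow_ne_top_of_nonneg (by positivity) hID
  set A := (∫⁻ z, psg φ z ^ p) ^ (1/p) with hA
  have hAle : A ≤ AG + AD := by
    have := ENNReal.lintegral_Lp_add_le (μ := volume) (f := fun z => ENNReal.ofReal (psG φ z)) (g := fun z => ENNReal.ofReal ‖halfDerivFun φ z‖)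
      (p := p) (by fun_prop) (by fun_prop) hp1.le
    refine le_trans (le_of_eq ?_) this
    rw [hA]
    congr 2
    ext z
    simp [psg, ofReal_norm]
  have hAt : A ≠ ∞ := ne_top_of_le_ne_top (ENNReal.add_ne_top.2 ⟨hAG, hAD⟩) hAle
  have hAp : A ^ p = ∫⁻ z, psg φ z ^ p := by
    rw [hA, ← ENNReal.rpow_mul, one_div, inv_mul_cancel₀ hp0.ne', ENNReal.rpow_one]
  have hIt : (∫⁻ z, psg φ z ^ p) ≠ ∞ := by rw [← hAp]; exact ENNReal.rpow_ne_top_of_nonneg hp0.le hAt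
  have hMM := H3 _ hgm
  have hMae : ∀ᵐ z, psMM (psg φ) z ≠ ∞ := by
    have := ae_lt_top ((ps_MM_meas hgm).pow_const p) (ne_top_of_le_ne_top (ENNReal.mul_ne_top hC3 hIt) hMM)
    filter_upwards [this] with z hz hz2
    rw [hz2, ENNReal.top_rpow_of_pos hp0] at hz
    exact lt_irrefl _ hz
  have hAq : (A ^ (p/(n+2))) ^ q ≠ ∞ := ENNReal.rpow_ne_top_of_nonneg hq0.le (ENNReal.rpow_ne_top_of_nonneg hpn0 hAt)
  have hmain : ∫⁻ z, ENNReal.ofReal ‖φ z‖ ^ q ≤ ENNReal.ofReal K ^ q * (C3 * A ^ q) := by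
    calc ∫⁻ z, ENNReal.ofReal ‖φ z‖ ^ q ≤ ∫⁻ z, (ENNReal.ofReal K ^ q * (A ^ (p/(n+2))) ^ q) * psMM (psg φ) z ^ p := by
          refine lintegral_mono_ae ?_
          filter_upwards [hMae] with z hz
          rw [ofReal_norm]
          refine (ENNReal.rpow_le_rpow (HK φ h hc hIt z hz) hq0.le).trans (le_of_eq ?_)
          rw [ENNReal.mul_rpow_of_nonneg _ _ hq0.le, ENNReal.mul_rpow_of_nonneg _ _ hq0.le, ← ENNReal.rpow_mul (psMM (psg φ) z), hqp]
          ring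
      _ = (ENNReal.ofReal K ^ q * (A ^ (p/(n+2))) ^ q) * ∫⁻ z, psMM (psg φ) z ^ p :=
          lintegral_const_mul' _ _ (ENNReal.mul_ne_top (ENNReal.rpow_ne_top_of_nonneg hq0.le (by simp)) hAq)
      _ ≤ (ENNReal.ofReal K ^ q * (A ^ (p/(n+2))) ^ q) * (C3 * A ^ p) := by
          rw [hAp]
          gcongr
      _ = _ := by
          have : A ^ q = (A ^ (p/(n+2))) ^ q * A ^ p := by
            rw [← ENNReal.rpow_mul A, ← ENNReal.rpow_add_of_nonneg _ _ (by positivity) hp0.le, hqA]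
          rw [this]; ring
  have hq1 : (∫⁻ z, ENNReal.ofReal ‖φ z‖ ^ q) ^ (1/q) ≤ Cc * (AG + AD) := by
    refine (ENNReal.rpow_le_rpow hmain (by positivity)).trans ?_
    rw [ENNReal.mul_rpow_of_nonneg _ _ (by positivity), ENNReal.mul_rpow_of_nonneg _ _ (by positivity), ← ENNReal.rpow_mul, ← ENNReal.rpow_mul,
      mul_one_div_cancel hq0.ne', ENNReal.rpow_one, ENNReal.rpow_one, ← mul_assoc]
    gcongr
  have hfin := ENNReal.toReal_mono (ENNReal.mul_ne_top hCc (ENNReal.add_ne_top.2 ⟨hAG, hAD⟩)) hq1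
  rw [ENNReal.toReal_mul, ENNReal.toReal_add hAG hAD] at hfin
  have h9 : 0 ≤ AG.toReal + AD.toReal := by positivity
  linarith

end
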